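/- Let K be a simplicial triangulation of a compact flat polyhedron P ⊂ ℝ^n whose support is an n-manifold with boundary, let L be a (possibly empty) subcomplex of K with |L| ⊇ ∂P, and let αK be a subdivision of K that agrees with K on |L| (induces the same complex L there). Then there exists s ∈ ℕ and s-fold derived subdivisions β^s(αK) and β^s K, agreeing on a common s-fold derived subdivision β^s L of L, such that β^s(αK) and β^s K are related by a finite sequence of geometric bistellar moves each of which keeps the subcomplex β^s L fixed. -/

import Mathlib

open Set
open scoped Classical

variable {E : Type*} [NormedAddCommGroup E] [NormedSpace ℝ E]

/-- `K'` is a subdivision of `K`: same support, and every simplex of `K'` is contained in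
some simplex of `K`. -/
def IsSubdivision (K' K : Geometry.SimplicialComplex ℝ E) : Prop :=
  K'.space = K.space ∧
    ∀ s ∈ K'.faces, ∃ t ∈ K.faces, convexHull ℝ (s : Set E) ⊆ convexHull ℝ (t : Set E)

/-- `K'` is a derived subdivision of `K`: for each simplex `A` of `K` an interior point `b A`
(in the relative interior of its convex hull; for a vertex this forces `b {x} = x`) is chosen,
and the simplices of `K'` are exactly the convex hulls of the sets `{b A₀, …, b Aₖ}` for chains
`A₀ ⊊ ⋯ ⊊ Aₖ` of simplices of `K`. -/
def IsDerivedSubdivision (K' K : Geometry.SimplicialComplex ℝ E) : Prop :=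
  ∃ b : Finset E → E,
    (∀ s ∈ K.faces, b s ∈ intrinsicInterior ℝ (convexHull ℝ (s : Set E))) ∧
    K'.faces = {S | ∃ T : Finset (Finset E), ↑T ⊆ K.faces ∧ T.Nonempty ∧
      (∀ A ∈ T, ∀ B ∈ T, A ⊆ B ∨ B ⊆ A) ∧ S = T.image b}

/-- `K'` is an `s`-fold iterated derived subdivision of `K`. -/
def IsIterDerived : ℕ → Geometry.SimplicialComplex ℝ E → Geometry.SimplicialComplex ℝ E → Prop
  | 0, K', K => K' = K
  | (s + 1), K', K => ∃ K'', IsIterDerived s K'' K ∧ IsDerivedSubdivision K' K''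

/-- The geometric bistellar move `κ(A,B)` on an `n`-dimensional complex: `A` is a simplex of `K`,
`B` is a simplex not in `K` with `dim A + dim B = n` (i.e. `card A + card B = n + 2`), the link
of `A` in `K` is the boundary complex of `B`, and `K'` is obtained from `K` by replacing
`A ⋆ ∂B` (the simplices containing `A`) with `∂A ⋆ B`; the result is again a geometric
simplicial complex with the same support. -/
def BistellarMove (n : ℕ) (K K' : Geometry.SimplicialComplex ℝ E) : Prop :=
  ∃ A B : Finset E, A ∈ K.faces ∧ B ∉ K.faces ∧ B.Nonempty ∧
    A.card + B.card = n + 2 ∧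
    {C : Finset E | C.Nonempty ∧ Disjoint A C ∧ A ∪ C ∈ K.faces} =
      {C : Finset E | C.Nonempty ∧ C ⊂ B} ∧
    K'.faces = (K.faces \ {s | A ⊆ s}) ∪ {s | ∃ A' : Finset E, A' ⊂ A ∧ s = A' ∪ B} ∧
    K'.space = K.space

/-- `h` is a regular function for the triangulation `K` of a flat `d`-dimensional polyhedron:
it is affine on each simplex of `K` and strictly convex across each codimension-one simplex,
i.e. for `x`, `y` in distinct `d`-simplices sharing a common `(d-1)`-face, the open segment
from `(x, h x)` to `(y, h y)` lies strictly above the graph of `h`. -/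
def IsRegularFunction (d : ℕ) (K : Geometry.SimplicialComplex ℝ E) (h : E → ℝ) : Prop :=
  (∀ s ∈ K.faces, ∃ g : E →ᵃ[ℝ] ℝ, ∀ x ∈ convexHull ℝ (s : Set E), h x = g x) ∧
  (∀ σ ∈ K.faces, ∀ σ' ∈ K.faces, σ ≠ σ' → σ.card = d + 1 → σ'.card = d + 1 →
    (σ ∩ σ').card = d →
    ∀ x ∈ convexHull ℝ (σ : Set E), ∀ y ∈ convexHull ℝ (σ' : Set E),
      ∀ t : ℝ, t ∈ Set.Ioo (0 : ℝ) 1 → (1 - t) • x + t • y ∈ K.space →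
        h ((1 - t) • x + t • y) < (1 - t) * h x + t * h y)

/-- `K` is a regular triangulation (of a flat `d`-dimensional polyhedron). -/
def IsRegularTriangulation (d : ℕ) (K : Geometry.SimplicialComplex ℝ E) : Prop :=
  ∃ h : E → ℝ, IsRegularFunction d K h

/-- `P` is strictly star-convex: there is an interior point `x` such that for every `y ∈ P`
the open segment from `x` to `y` lies in the interior of `P`. -/
def StrictlyStarConvex (P : Set E) : Prop :=
  ∃ x ∈ interior P, ∀ y ∈ P, ∀ t ∈ Set.Ioo (0 : ℝ) 1, (1 - t) • x + t • y ∈ interior P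

namespace BistellarDerived

/-! ### Affine functionals and positive combinations -/

theorem map_sum_smul (l : E →ᵃ[ℝ] ℝ) {s : Finset E} {a : E → ℝ} (ha : ∑ v ∈ s, a v = 1) :
    l (∑ v ∈ s, a v • v) = ∑ v ∈ s, a v * l v := by
  have h : ∀ y, l y = l.linear y + l 0 := fun y => by
    have := congrFun l.decomp y
    simpa using this
  rw [h, map_sum]
  have : ∀ v ∈ s, a v * l v = l.linear (a v • v) + a v * l 0 := fun v _ => by
    rw [h v, map_smul, smul_eq_mul]; ring
  rw [Finset.sum_congr rfl this, Finset.sum_add_distrib, ← Finset.sum_mul, ha, one_mul]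

/-- An affinely independent finite set extends to an affine basis; the functions `c u` are the
corresponding barycentric coordinates. -/
theorem exists_coords [FiniteDimensional ℝ E] {s : Finset E}
    (hs : AffineIndependent ℝ ((↑) : s → E)) :
    ∃ (t : Finset E) (c : E → E →ᵃ[ℝ] ℝ), s ⊆ t ∧ t.card = Module.finrank ℝ E + 1 ∧
      (∀ u ∈ t, ∀ v ∈ t, c u v = if u = v then 1 else 0) ∧
      (∀ y, ∑ u ∈ t, c u y = 1) ∧ ∀ y, ∑ u ∈ t, c u y • u = y := by
  obtain ⟨t, hst, hi, ht⟩ := exists_subset_affineIndependent_affineSpan_eq_top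
    (k := ℝ) (P := E) (s := (s : Set E)) hs
  have hfin : t.Finite := finite_set_of_fin_dim_affineIndependent ℝ hi
  lift t to Finset E using hfin
  let b : AffineBasis t ℝ E := ⟨(↑), hi, by simpa using ht⟩
  have hb : ∀ u : t, b u = u := fun u => rfl
  refine ⟨t, fun u => if h : u ∈ t then b.coord ⟨u, h⟩ else 0, by exact_mod_cast hst,
    ?_, ?_, ?_, ?_⟩
  · have := b.card_eq_finrank_add_one
    simpa using this
  · intro u hu v hv
    simp only [hu, dif_pos]
    have := b.coord_apply ⟨u, hu⟩ ⟨v, hv⟩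
    simpa [hb] using this
  · intro y
    rw [← Finset.sum_coe_sort]
    simpa using b.sum_coord_apply_eq_one y
  · intro y
    rw [← Finset.sum_coe_sort]
    simpa [hb] using b.linear_combination_coord_eq_self y

theorem exists_affine_eq [FiniteDimensional ℝ E] {s : Finset E}
    (hs : AffineIndependent ℝ ((↑) : s → E)) (r : E → ℝ) :
    ∃ l : E →ᵃ[ℝ] ℝ, ∀ v ∈ s, l v = r v := by
  obtain ⟨t, c, hst, -, hc, -, -⟩ := exists_coords hs
  refine ⟨∑ u ∈ s, r u • c u, fun v hv => ?_⟩
  have : (∑ u ∈ s, r u • c u) v = ∑ u ∈ s, r u * c u v := by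
    have h : ∀ s' : Finset E, (∑ u ∈ s', r u • c u) v = ∑ u ∈ s', r u * c u v := fun s' => by
      induction s' using Finset.induction_on with
      | empty => simp
      | insert a s' ha ih => rw [Finset.sum_insert ha, Finset.sum_insert ha, ← ih]; simp
    exact h s
  rw [this, Finset.sum_eq_single v]
  · simp [hc v (hst hv) v (hst hv)]
  · intro u hu huv
    simp [hc u (hst hu) v (hst hv), huv]
  · exact fun h => (h hv).elim

/-- `y` is a convex combination of the points of `s` with positive coefficients. -/
def PosComb (s : Finset E) (y : E) : Prop :=
  ∃ a : E → ℝ, (∀ v ∈ s, 0 < a v) ∧ ∑ v ∈ s, a v = 1 ∧ ∑ v ∈ s, a v • v = y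

theorem PosComb.mem_convexHull {s : Finset E} {y : E} (h : PosComb s y) :
    y ∈ convexHull ℝ (s : Set E) := by
  obtain ⟨a, h0, h1, h2⟩ := h
  exact Finset.mem_convexHull'.2 ⟨a, fun v hv => (h0 v hv).le, h1, h2⟩

theorem PosComb.nonempty {s : Finset E} {y : E} (h : PosComb s y) : s.Nonempty := by
  obtain ⟨a, h0, h1, h2⟩ := h
  by_contra hs
  simp [Finset.not_nonempty_iff_eq_empty.1 hs] at h1

theorem exists_posComb {s : Finset E} (hs : s.Nonempty) : ∃ y, PosComb s y := by
  have : (0 : ℝ) < s.card := by exact_mod_cast hs.card_pos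
  exact ⟨_, fun _ => (s.card : ℝ)⁻¹, fun _ _ => by positivity, by simp [this.ne'], rfl⟩

theorem exists_posComb_of_mem_convexHull {s : Finset E} {y : E}
    (h : y ∈ convexHull ℝ (s : Set E)) : ∃ t ⊆ s, PosComb t y := by
  obtain ⟨a, h0, h1, h2⟩ := Finset.mem_convexHull'.1 h
  refine ⟨s.filter fun v => 0 < a v, Finset.filter_subset _ _, a, by simp, ?_, ?_⟩
  · rw [← h1]
    refine Finset.sum_subset (Finset.filter_subset _ _) fun v hv hv' => ?_
    have := h0 v hv
    have : ¬ 0 < a v := fun h => hv' (Finset.mem_filter.2 ⟨hv, h⟩)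
    linarith
  · rw [← h2]
    refine Finset.sum_subset (Finset.filter_subset _ _) fun v hv hv' => ?_
    have h3 := h0 v hv
    have : ¬ 0 < a v := fun h => hv' (Finset.mem_filter.2 ⟨hv, h⟩)
    have : a v = 0 := by linarith
    simp [this]

/-- Adding a multiple of a convex combination of `s` to a positive combination of `s` keeps all
coefficients positive. -/
theorem PosComb.lineMap {s t : Finset E} {y z : E} (hy : PosComb s y)
    (hz : z ∈ convexHull ℝ (t : Set E)) (hts : t ⊆ s) {θ : ℝ} (h0 : 0 ≤ θ) (h1 : θ < 1) :
    PosComb s ((1 - θ) • y + θ • z) := by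
  obtain ⟨a, ha0, ha1, rfl⟩ := hy
  obtain ⟨b, hb0, hb1, rfl⟩ := Finset.mem_convexHull'.1
    (convexHull_mono (by exact_mod_cast hts) hz :
    z ∈ convexHull ℝ (s : Set E))
  refine ⟨fun v => (1 - θ) * a v + θ * b v, fun v hv => ?_, ?_, ?_⟩
  · have := ha0 v hv
    have := hb0 v hv
    have : 0 < 1 - θ := by linarith
    positivity
  · rw [Finset.sum_add_distrib, ← Finset.mul_sum, ← Finset.mul_sum, ha1, hb1]; ring
  · simp only [add_smul, mul_smul, Finset.sum_add_distrib, Finset.smul_sum]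

theorem PosComb.le_of_forall_le {s : Finset E} {y : E} (h : PosComb s y) {l l' : E →ᵃ[ℝ] ℝ}
    (hl : ∀ v ∈ s, l v ≤ l' v) : l y ≤ l' y := by
  obtain ⟨a, h0, h1, rfl⟩ := h
  rw [map_sum_smul _ h1, map_sum_smul _ h1]
  exact Finset.sum_le_sum fun v hv => mul_le_mul_of_nonneg_left (hl v hv) (h0 v hv).le

theorem PosComb.lt_of_forall_le {s : Finset E} {y : E} (h : PosComb s y) {l l' : E →ᵃ[ℝ] ℝ}
    (hl : ∀ v ∈ s, l v ≤ l' v) {u : E} (hu : u ∈ s) (hlu : l u < l' u) : l y < l' y := by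
  obtain ⟨a, h0, h1, rfl⟩ := h
  rw [map_sum_smul _ h1, map_sum_smul _ h1]
  exact Finset.sum_lt_sum (fun v hv => mul_le_mul_of_nonneg_left (hl v hv) (h0 v hv).le)
    ⟨u, hu, mul_lt_mul_of_pos_left hlu (h0 u hu)⟩

theorem le_of_mem_convexHull {s : Finset E} {y : E} (h : y ∈ convexHull ℝ (s : Set E))
    {l l' : E →ᵃ[ℝ] ℝ} (hl : ∀ v ∈ s, l v ≤ l' v) : l y ≤ l' y := by
  obtain ⟨t, hts, ht⟩ := exists_posComb_of_mem_convexHull h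
  exact ht.le_of_forall_le fun v hv => hl v (hts hv)

theorem eq_of_mem_convexHull {s : Finset E} {y : E} (h : y ∈ convexHull ℝ (s : Set E))
    {l l' : E →ᵃ[ℝ] ℝ} (hl : ∀ v ∈ s, l v = l' v) : l y = l' y :=
  le_antisymm (le_of_mem_convexHull h fun v hv => (hl v hv).le)
    (le_of_mem_convexHull h fun v hv => (hl v hv).ge)

theorem eq_of_mem_affineSpan {s : Set E} {y : E} (h : y ∈ affineSpan ℝ s)
    {l l' : E →ᵃ[ℝ] ℝ} (hl : ∀ v ∈ s, l v = l' v) : l y = l' y := by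
  have : s ⊆ (AffineSubspace.comap (l - l') (AffineSubspace.mk' (0 : ℝ) ⊥) : Set E) :=
    fun v hv => by
    simp [hl v hv]
  have h2 := (affineSpan_le.2 this) h
  simpa [sub_eq_zero] using h2

/-- A face of a simplex which contains a point of the relative interior of a convex set contained
in the simplex contains that convex set. -/
theorem mem_convexHull_of_posComb [FiniteDimensional ℝ E] {s t A : Finset E} {y : E}
    (hs : AffineIndependent ℝ ((↑) : s → E)) (hts : t ⊆ s)
    (hA : ∀ v ∈ A, v ∈ convexHull ℝ (s : Set E)) (hy : PosComb A y)
    (hyt : y ∈ convexHull ℝ (t : Set E)) {v : E} (hv : v ∈ A) :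
    v ∈ convexHull ℝ (t : Set E) := by
  obtain ⟨l, hl⟩ := exists_affine_eq hs fun v => if v ∈ t then 0 else 1
  have hl0 : ∀ v ∈ s, (AffineMap.const ℝ E (0 : ℝ)) v ≤ l v := fun v hv => by
    rw [hl v hv]; split_ifs <;> simp
  have hly : l y = (AffineMap.const ℝ E (0 : ℝ)) y :=
    eq_of_mem_convexHull hyt fun v hv => by rw [hl v (hts hv)]; simp [hv]
  have hlv : l v ≤ 0 := by
    by_contra! h
    have := hy.lt_of_forall_le (fun v hv => le_of_mem_convexHull (hA v hv) hl0) hv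
      (by simpa using h)
    linarith
  obtain ⟨r, hrs, hr⟩ := exists_posComb_of_mem_convexHull (hA v hv)
  have hrt : r ⊆ t := by
    intro u hu
    by_contra hut
    have := hr.lt_of_forall_le (fun v hv => hl0 v (hrs hv)) hu (by simp [hl u (hrs hu), hut])
    simp at this
    linarith
  exact convexHull_mono (by exact_mod_cast hrt) hr.mem_convexHull

theorem subset_of_posComb [FiniteDimensional ℝ E] {s t : Finset E} {y : E}
    (hs : AffineIndependent ℝ ((↑) : s → E)) (hts : t ⊆ s) (hy : PosComb s y)
    (hyt : y ∈ convexHull ℝ (t : Set E)) : s ⊆ t := by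
  obtain ⟨l, hl⟩ := exists_affine_eq hs fun v => if v ∈ t then 0 else 1
  intro v hv
  by_contra hvt
  have h1 := hy.lt_of_forall_le (l := AffineMap.const ℝ E (0 : ℝ)) (l' := l)
    (fun v hv => by rw [hl v hv]; split_ifs <;> simp) hv (by simp [hl v hv, hvt])
  have h2 : l y = (AffineMap.const ℝ E (0 : ℝ)) y :=
    eq_of_mem_convexHull hyt fun v hv => by rw [hl v (hts hv)]; simp [hv]
  linarith

theorem subset_of_mem_faces [FiniteDimensional ℝ E] {K : Geometry.SimplicialComplex ℝ E}
    {s t : Finset E} {y : E} (hs : s ∈ K.faces) (ht : t ∈ K.faces) (hy : PosComb s y)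
    (hyt : y ∈ convexHull ℝ (t : Set E)) : s ⊆ t := by
  have := K.inter_subset_convexHull hs ht ⟨hy.mem_convexHull, hyt⟩
  rw [← Finset.coe_inter] at this
  exact (subset_of_posComb (K.indep hs) Finset.inter_subset_left hy this).trans
    Finset.inter_subset_right

theorem PosComb.mem_intrinsicInterior [FiniteDimensional ℝ E] {s : Finset E} {y : E}
    (hs : AffineIndependent ℝ ((↑) : s → E)) (hy : PosComb s y) :
    y ∈ intrinsicInterior ℝ (convexHull ℝ (s : Set E)) := by
  obtain ⟨t, c, hst, -, hc, h1, h2⟩ := exists_coords hs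
  have hcv : ∀ u ∈ t, u ∉ s → ∀ z ∈ affineSpan ℝ (convexHull ℝ (s : Set E)), c u z = 0 := by
    intro u hu hus z hz
    rw [affineSpan_convexHull] at hz
    refine eq_of_mem_affineSpan (l' := AffineMap.const ℝ E (0 : ℝ)) hz fun v hv => ?_
    rw [hc u hu v (hst hv), if_neg (by rintro rfl; exact hus hv)]; simp
  rw [_root_.mem_intrinsicInterior]
  refine ⟨⟨y, subset_affineSpan _ _ hy.mem_convexHull⟩, ?_, rfl⟩
  rw [mem_interior]
  refine ⟨{z | ∀ u ∈ s, 0 < c u z}, ?_, ?_, ?_⟩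
  · rintro ⟨z, hz⟩ hzu
    simp only [Set.mem_ofPred_eq] at hzu
    refine Finset.mem_convexHull'.2 ⟨fun u => c u z, fun u hu => (hzu u hu).le, ?_, ?_⟩
    · rw [← h1 z]
      exact Finset.sum_subset hst fun u hu hus => hcv u hu hus z hz
    · refine Eq.trans ?_ (h2 z)
      exact Finset.sum_subset hst fun u hu hus => by simp [hcv u hu hus z hz]
  · have : {z : affineSpan ℝ (convexHull ℝ (s : Set E)) | ∀ u ∈ s, 0 < c u z} =
        ⋂ u ∈ s, {z : affineSpan ℝ (convexHull ℝ (s : Set E)) | 0 < c u z} := by ext; simp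
    rw [this]
    refine isOpen_biInter_finset fun u _ => ?_
    exact isOpen_lt continuous_const
      ((AffineMap.continuous_of_finiteDimensional (c u)).comp continuous_subtype_val)
  · intro u hu
    have := hy.lt_of_forall_le (l := AffineMap.const ℝ E (0 : ℝ)) (l' := c u) (fun v hv => by
      rw [hc u (hst hu) v (hst hv)]; split_ifs <;> simp) hu (by simp [hc u (hst hu) u (hst hu)])
    simpa using this

/-! ### Certificates -/

/-- `s` is the set of contact points of the function `w` on `V` with some affine functional
lying below it. -/
def Cert (V : Finset E) (w : E → ℝ) (s : Finset E) : Prop :=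
  ∃ l : E →ᵃ[ℝ] ℝ, (∀ v ∈ s, l v = w v) ∧ ∀ v ∈ V, v ∉ s → l v < w v

theorem Cert.subset_right {V V' s : Finset E} {w : E → ℝ} (h : Cert V w s) (hV : V' ⊆ V) :
    Cert V' w s := by
  obtain ⟨l, h1, h2⟩ := h
  exact ⟨l, h1, fun v hv => h2 v (hV hv)⟩

theorem Cert.subset_of_posComb {V s s' : Finset E} {w : E → ℝ} {y : E} {l : E →ᵃ[ℝ] ℝ}
    (hl : ∀ v ∈ s, l v = w v) (hlV : ∀ v ∈ V, l v ≤ w v) (hsV : s ⊆ V) (h : Cert V w s')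
    (hsV' : s' ⊆ V) (hy : PosComb s y) (hy' : y ∈ convexHull ℝ (s' : Set E)) : s ⊆ s' := by
  obtain ⟨l', h1, h2⟩ := h
  intro v hv
  by_contra hvs
  have hle : ∀ v ∈ s, l' v ≤ l v := fun u hu => by
    rw [hl u hu]
    by_cases hus : u ∈ s'
    · exact (h1 u hus).le
    · exact (h2 u (hsV hu) hus).le
  have := hy.lt_of_forall_le hle hv (by rw [hl v hv]; exact h2 v (hsV hv) hvs)
  have := le_of_mem_convexHull hy' (l := l) (l' := l') fun u hu => by
    rw [h1 u hu]; exact hlV u (hsV' hu)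
  linarith

theorem affineIndependent_of_cert {s : Finset E} {w : E → ℝ}
    (h : ∀ t ⊆ s, t.Nonempty → Cert s w t) : AffineIndependent ℝ ((↑) : s → E) := by
  by_contra hs
  obtain ⟨I, y, hy1, hy2⟩ := Convex.radon_partition hs
  let t : Finset E := (Finset.univ.filter (· ∈ I)).image (↑)
  let t' : Finset E := (Finset.univ.filter (· ∈ Iᶜ)).image (↑)
  have ht : ((↑) : s → E) '' I = (t : Set E) := by simp [t]
  have ht' : ((↑) : s → E) '' Iᶜ = (t' : Set E) := by simp [t']; rfl
  rw [ht] at hy1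
  rw [ht'] at hy2
  have hts : t ⊆ s := fun v hv => by
    simp only [t, Finset.mem_image] at hv
    obtain ⟨a, -, rfl⟩ := hv
    exact a.2
  have hts' : t' ⊆ s := fun v hv => by
    simp only [t', Finset.mem_image] at hv
    obtain ⟨a, -, rfl⟩ := hv
    exact a.2
  obtain ⟨r, hr, hry⟩ := exists_posComb_of_mem_convexHull hy1
  obtain ⟨r', hr', hry'⟩ := exists_posComb_of_mem_convexHull hy2
  obtain ⟨l, hl1, hl2⟩ := h r (hr.trans hts) hry.nonempty
  have := Cert.subset_of_posComb hl1 (fun v hv => by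
    by_cases hvr : v ∈ r
    · exact (hl1 v hvr).le
    · exact (hl2 v hv hvr).le) (hr.trans hts) (h r' (hr'.trans hts') hry'.nonempty)
    (hr'.trans hts') hry hry'.mem_convexHull
  obtain ⟨v, hv⟩ := hry.nonempty
  have h1 := hr hv
  have h2 := hr' (this hv)
  simp only [t, t', Finset.mem_image, Finset.mem_filter] at h1 h2
  obtain ⟨a, ⟨-, ha⟩, rfl⟩ := h1
  obtain ⟨b, ⟨-, hb⟩, hab⟩ := h2
  rw [Subtype.ext hab] at hb
  exact hb ha

theorem eventually_add_mul_lt {ι : Type*} {V : Set ι} (hV : V.Finite) {a b c : ι → ℝ}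
    (h : ∀ v ∈ V, a v < c v) :
    ∀ᶠ ε : ℝ in nhdsWithin 0 (Ioi 0), ∀ v ∈ V, a v + ε * b v < c v := by
  refine (Filter.eventually_all_finite hV).2 fun v hv => ?_
  have : Filter.Tendsto (fun ε : ℝ => a v + ε * b v) (nhds 0) (nhds (a v + 0 * b v)) :=
    (Continuous.tendsto (by fun_prop) _)
  refine Filter.Eventually.filter_mono nhdsWithin_le_nhds
    (this.eventually (gt_mem_nhds (by simpa using h v hv)))

theorem Cert.mono [FiniteDimensional ℝ E] {V s t : Finset E} {w : E → ℝ} (h : Cert V w s)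
    (hs : AffineIndependent ℝ ((↑) : s → E)) (hts : t ⊆ s) : Cert V w t := by
  obtain ⟨l, h1, h2⟩ := h
  obtain ⟨γ, hγ⟩ := exists_affine_eq hs fun v => if v ∈ t then 0 else -1
  have := eventually_add_mul_lt (V := {v | v ∈ V ∧ v ∉ s}) (V.finite_toSet.subset fun v hv => hv.1)
    (a := l) (b := γ) (c := w) fun v hv => h2 v hv.1 hv.2
  obtain ⟨ε, hε, hpos⟩ := (this.and self_mem_nhdsWithin).exists
  have hpos : 0 < ε := hpos
  refine ⟨l + ε • γ, fun v hv => by simp [h1 v (hts hv), hγ v (hts hv), hv], fun v hv hvt => ?_⟩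
  by_cases hvs : v ∈ s
  · simp [h1 v hvs, hγ v hvs, hvt, hpos]
  · simpa using hε v ⟨hv, hvs⟩

/-- A family of certified finite sets closed under nonempty subsets is a simplicial complex. -/
def ofCert (V : Finset E) (w : E → ℝ) (F : Set (Finset E)) (hne : ∀ s ∈ F, s.Nonempty)
    (hV : ∀ s ∈ F, s ⊆ V) (hd : ∀ s ∈ F, ∀ t ⊆ s, t.Nonempty → t ∈ F)
    (hc : ∀ s ∈ F, Cert V w s) : Geometry.SimplicialComplex ℝ E where
  faces := F
  isRelLowerSet_faces := fun s hs => ⟨hne s hs, fun t hts ht => hd s hs t hts ht⟩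
  indep := fun {s} hs => affineIndependent_of_cert fun t hts ht =>
    (hc t (hd s hs t hts ht)).subset_right (hV s hs)
  inter_subset_convexHull := by
    rintro s t hs ht y ⟨hy1, hy2⟩
    obtain ⟨r, hr, hry⟩ := exists_posComb_of_mem_convexHull hy1
    obtain ⟨l, hl1, hl2⟩ := hc r (hd s hs r hr hry.nonempty)
    have := Cert.subset_of_posComb hl1 (fun v hv => by
      by_cases hvr : v ∈ r
      · exact (hl1 v hvr).le
      · exact (hl2 v hv hvr).le) (hr.trans (hV s hs)) (hc t ht) (hV t ht) hry hy2
    rw [← Finset.coe_inter]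
    exact convexHull_mono (by exact_mod_cast Finset.subset_inter hr this) hry.mem_convexHull

/-- `T` is a lower envelope complex of the heights `w` on the points `V`. -/
structure Certified (V : Finset E) (w : E → ℝ) (T : Geometry.SimplicialComplex ℝ E) : Prop where
  subset : ∀ s ∈ T.faces, s ⊆ V
  cert : ∀ s ∈ T.faces, Cert V w s

theorem Certified.finite {V : Finset E} {w : E → ℝ} {T : Geometry.SimplicialComplex ℝ E}
    (h : Certified V w T) : T.faces.Finite :=
  V.powerset.finite_toSet.subset fun s hs => by simpa using h.subset s hs

theorem Certified.mem_faces {V s : Finset E} {w : E → ℝ} {T : Geometry.SimplicialComplex ℝ E}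
    (h : Certified V w T) {l : E →ᵃ[ℝ] ℝ} (hl : ∀ v ∈ s, l v = w v) (hlV : ∀ v ∈ V, l v ≤ w v)
    (hsV : s ⊆ V) {y : E} (hy : PosComb s y) (hyT : y ∈ T.space) : s ∈ T.faces := by
  obtain ⟨t, ht, hyt⟩ := Geometry.SimplicialComplex.mem_space_iff.1 hyT
  exact T.down_closed ht (Cert.subset_of_posComb hl hlV hsV (h.cert t ht) (h.subset t ht) hy hyt)
    hy.nonempty

theorem Certified.mem_faces_of_cert {V s : Finset E} {w : E → ℝ}
    {T : Geometry.SimplicialComplex ℝ E} (h : Certified V w T) (hs : Cert V w s)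
    (hsV : s ⊆ V) {y : E} (hy : PosComb s y) (hyT : y ∈ T.space) : s ∈ T.faces := by
  obtain ⟨l, h1, h2⟩ := hs
  refine h.mem_faces h1 (fun v hv => ?_) hsV hy hyT
  by_cases hvs : v ∈ s
  · exact (h1 v hvs).le
  · exact (h2 v hv hvs).le

theorem Certified.eq_of_space_eq {V : Finset E} {w : E → ℝ} {T T' : Geometry.SimplicialComplex ℝ E}
    (h : Certified V w T) (h' : Certified V w T') (hTT : T.space = T'.space) : T = T' := by
  have key : ∀ {T T' : Geometry.SimplicialComplex ℝ E}, Certified V w T → Certified V w T' →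
      T.space = T'.space → T.faces ⊆ T'.faces := fun {T T'} h h' hTT s hs => by
    obtain ⟨y, hy⟩ := exists_posComb (T.nonempty_of_mem_faces hs)
    exact h'.mem_faces_of_cert (h.cert s hs) (h.subset s hs) hy
      (hTT ▸ T.convexHull_subset_space hs hy.mem_convexHull)
  exact Geometry.SimplicialComplex.ext ((key h h' hTT).antisymm (key h' h hTT.symm))

/-! ### Bistellar moves are reversible -/

theorem bistellarMove_symm {n : ℕ} {K K' : Geometry.SimplicialComplex ℝ E}
    (h : BistellarMove n K K') : BistellarMove n K' K := by
  obtain ⟨A, B, hA, hB, hBne, hcard, hlink, hfaces, hspace⟩ := h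
  have hAne := K.nonempty_of_mem_faces hA
  have hlink' : ∀ C : Finset E, (C.Nonempty ∧ Disjoint A C ∧ A ∪ C ∈ K.faces) ↔
      (C.Nonempty ∧ C ⊂ B) := fun C => Set.ext_iff.1 hlink C
  have hBA : ¬ B ⊆ A := fun h => hB (K.down_closed hA h hBne)
  have hdis : Disjoint B A := by
    rw [Finset.disjoint_left]
    intro b hbB hbA
    have hss : ({b} : Finset E) ⊂ B := by
      refine (Finset.ssubset_iff_subset_ne.2 ⟨by simpa using hbB, ?_⟩)
      rintro rfl
      exact hBA (by simpa using hbA)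
    have := ((hlink' {b}).2 ⟨by simp, hss⟩).2.1
    simp [hbA] at this
  have hmem : ∀ s, s ∈ K'.faces ↔ (s ∈ K.faces ∧ ¬ A ⊆ s) ∨ ∃ A' ⊂ A, s = A' ∪ B := fun s => by
    rw [hfaces]; simp
  refine ⟨B, A, ?_, ?_, hAne, by omega, ?_, ?_, hspace.symm⟩
  · exact (hmem B).2 (Or.inr ⟨∅,
      by simpa [Finset.ssubset_iff_subset_ne, eq_comm] using hAne.ne_empty,
      by simp⟩)
  · intro h
    rcases (hmem A).1 h with h | ⟨A', -, h⟩
    · exact h.2 subset_rfl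
    · exact hBA (h ▸ Finset.subset_union_right)
  · ext C
    simp only [Set.mem_ofPred_eq]
    refine and_congr_right fun hC => ⟨?_, ?_⟩
    · rintro ⟨hd, h⟩
      rcases (hmem _).1 h with h | ⟨A', hA', h⟩
      · exact (hB (K.down_closed h.1 Finset.subset_union_left hBne)).elim
      · refine lt_of_le_of_lt (fun c hc => ?_) hA'
        have : c ∈ A' ∪ B := h ▸ Finset.mem_union_right _ hc
        rcases Finset.mem_union.1 this with h | h
        · exact h
        · exact (Finset.disjoint_left.1 hd h hc).elim
    · intro h
      exact ⟨hdis.mono_right h.subset, (hmem _).2 (Or.inr ⟨C, h, Finset.union_comm _ _⟩)⟩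
  · ext s
    simp only [Set.mem_union, Set.mem_sdiff, Set.mem_ofPred_eq, hmem]
    constructor
    · intro hs
      by_cases hAs : A ⊆ s
      · right
        refine ⟨s \ A, ?_, (Finset.sdiff_union_of_subset hAs).symm⟩
        rcases (s \ A).eq_empty_or_nonempty with h | h
        · rw [h]; simpa [Finset.ssubset_iff_subset_ne, eq_comm] using hBne.ne_empty
        · exact ((hlink' _).1 ⟨h, Finset.disjoint_sdiff, by rwa [Finset.union_sdiff_of_subset hAs]⟩).2
      · exact Or.inl ⟨Or.inl ⟨hs, hAs⟩, fun h => hB (K.down_closed hs h hBne)⟩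
    · rintro (⟨⟨h, -⟩ | ⟨A', -, rfl⟩, hBs⟩ | ⟨B', hB', rfl⟩)
      · exact h
      · exact (hBs Finset.subset_union_right).elim
      · rcases B'.eq_empty_or_nonempty with rfl | h
        · simpa using hA
        · rw [Finset.union_comm]
          exact ((hlink' _).2 ⟨h, hB'⟩).2.2

/-- A path of bistellar moves, all keeping `M` fixed. -/
abbrev BistellarPath (n : ℕ) (M : Set (Finset E)) :
    Geometry.SimplicialComplex ℝ E → Geometry.SimplicialComplex ℝ E → Prop :=
  Relation.ReflTransGen fun X Y => BistellarMove n X Y ∧ M ⊆ X.faces ∧ M ⊆ Y.faces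

theorem BistellarPath.symm {n : ℕ} {M : Set (Finset E)} {X Y : Geometry.SimplicialComplex ℝ E}
    (h : BistellarPath n M X Y) : BistellarPath n M Y X := by
  induction h with
  | refl => exact .refl
  | tail _ h ih => exact .head ⟨bistellarMove_symm h.1, h.2.2, h.2.1⟩ ih

/-! ### Heights certifying the chains of faces of a simplex -/

/-- A family of finite sets totally ordered by inclusion. -/
def ChainFam {α : Type*} (T : Finset (Finset α)) : Prop :=
  ∀ A ∈ T, ∀ B ∈ T, A ⊆ B ∨ B ⊆ A

theorem ChainFam.mono {α : Type*} {T T' : Finset (Finset α)} (h : ChainFam T)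
    (hT : T' ⊆ T) : ChainFam T' :=
  fun A hA B hB => h A (hT hA) B (hT hB)

theorem ChainFam.exists_top {α : Type*} {T : Finset (Finset α)} (h : ChainFam T) (hT : T.Nonempty) :
    ∃ A ∈ T, ∀ B ∈ T, B ⊆ A := by
  obtain ⟨A, hA, hmax⟩ := Finset.exists_max_image T Finset.card hT
  refine ⟨A, hA, fun B hB => ?_⟩
  rcases h A hA B hB with h | h
  · rw [Finset.eq_of_subset_of_card_le h (hmax B hB)]
  · exact h

theorem eventually_sub_mul_lt {a m c : ℝ} (hm : 0 < m) :
    ∀ᶠ R : ℝ in Filter.atTop, a - R * m < c := by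
  filter_upwards [Filter.eventually_gt_atTop ((a - c) / m)] with R hR
  rw [div_lt_iff₀ hm] at hR
  linarith

theorem eventually_chain_heights [FiniteDimensional ℝ E] {A : Finset E}
    (hA : AffineIndependent ℝ ((↑) : A → E)) (hAne : A.Nonempty) {b : Finset E → E}
    (hb : ∀ B ⊆ A, B.Nonempty → PosComb B (b B)) {H : Finset E → ℝ} {T : Finset (Finset E)}
    (hT : T.Nonempty) (hTA : ∀ B ∈ T, B ⊆ A ∧ B.Nonempty) (hch : ChainFam T)
    (ih : ∀ A' ⊂ A, A'.Nonempty → ∀ T : Finset (Finset E), T.Nonempty →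
      (∀ B ∈ T, B ⊆ A' ∧ B.Nonempty) → ChainFam T →
      ∃ l : E →ᵃ[ℝ] ℝ, (∀ B ∈ T, l (b B) = H B) ∧
        ∀ B ⊆ A', B.Nonempty → B ∉ T → l (b B) < H B) :
    ∀ᶠ x : ℝ in Filter.atBot, ∃ l : E →ᵃ[ℝ] ℝ,
      (∀ B ∈ T, B ⊂ A → l (b B) = H B) ∧ (A ∈ T → l (b A) = x) ∧
      (∀ B ⊂ A, B.Nonempty → B ∉ T → l (b B) < H B) ∧ (A ∉ T → l (b A) < x) := by
  rcases (T.erase A).eq_empty_or_nonempty with hTe | hTe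
  · have hTA' : T = {A} := by
      rcases Finset.erase_eq_empty_iff _ _ |>.1 hTe with h | h
      · exact (hT.ne_empty h).elim
      · exact h
    subst hTA'
    have : ∀ᶠ x : ℝ in Filter.atBot, ∀ B ∈ A.powerset, x < H B :=
      (Filter.eventually_all_finset _).2 fun B _ => Filter.eventually_lt_atBot _
    filter_upwards [this] with x hx
    refine ⟨AffineMap.const ℝ E x, ?_, by simp, fun B hB _ _ => ?_, by simp⟩
    · intro B hB hBA
      exact (hBA.ne (by simpa using hB)).elim
    · simpa using hx B (by simpa using hB.subset)
  obtain ⟨A', hA'T, htop⟩ := (hch.mono (Finset.erase_subset A T)).exists_top hTe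
  have hA'2 := Finset.mem_erase.1 hA'T
  have hA' := hTA A' hA'2.2
  have hss : A' ⊂ A := Finset.ssubset_iff_subset_ne.2 ⟨hA'.1, hA'2.1⟩
  obtain ⟨l', hl1, hl2⟩ := ih A' hss hA'.2 (T.erase A) hTe
    (fun B hB => ⟨htop B hB, (hTA B (Finset.mem_of_mem_erase hB)).2⟩)
    (hch.mono (Finset.erase_subset A T))
  obtain ⟨l0, hl0⟩ := exists_affine_eq hA fun v => if v ∈ A' then l' v else 0
  obtain ⟨m, hm⟩ := exists_affine_eq hA fun v => if v ∈ A' then 0 else 1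
  have hpos : ∀ B ⊆ A, B.Nonempty → ¬ B ⊆ A' → 0 < m (b B) := fun B hB hne hBA => by
    obtain ⟨u, hu, huA⟩ := Finset.not_subset.1 hBA
    have := (hb B hB hne).lt_of_forall_le (l := AffineMap.const ℝ E (0 : ℝ)) (l' := m)
      (fun v hv => by rw [hm v (hB hv)]; split_ifs <;> simp) hu (by simp [hm u (hB hu), huA])
    simpa using this
  have hm0 : ∀ B ⊆ A', B.Nonempty → m (b B) = 0 ∧ l0 (b B) = l' (b B) := fun B hB hne => by
    have h := (hb B (hB.trans hA'.1) hne).mem_convexHull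
    refine ⟨?_, eq_of_mem_convexHull h fun v hv => by simp [hl0 v (hA'.1 (hB hv)), hB hv]⟩
    simpa using eq_of_mem_convexHull h (l' := AffineMap.const ℝ E (0 : ℝ))
      fun v hv => by simp [hm v (hA'.1 (hB hv)), hB hv]
  have hval : ∀ (R : ℝ) y, (l0 - R • m) y = l0 y - R * m y := fun R y => by simp
  have hev : ∀ᶠ R : ℝ in Filter.atTop, ∀ B ∈ A.powerset.filter (fun B => B.Nonempty ∧ ¬ B ⊆ A'),
      l0 (b B) - R * m (b B) < H B := by
    refine (Filter.eventually_all_finset _).2 fun B hB => ?_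
    simp only [Finset.mem_filter, Finset.mem_powerset] at hB
    exact eventually_sub_mul_lt (hpos B hB.1 hB.2.1 hB.2.2)
  have hsmall : ∀ R : ℝ, ∀ B ⊆ A', B.Nonempty → (l0 - R • m) (b B) = l' (b B) :=
    fun R B hB hne => by rw [hval, (hm0 B hB hne).1, (hm0 B hB hne).2]; ring
  have hmA := hpos A subset_rfl hAne (fun h => hss.2 h)
  have hfin : ∀ R : ℝ, (∀ B ∈ A.powerset.filter (fun B => B.Nonempty ∧ ¬ B ⊆ A'),
      l0 (b B) - R * m (b B) < H B) →
      (∀ B ∈ T, B ⊂ A → (l0 - R • m) (b B) = H B) ∧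
      (∀ B ⊂ A, B.Nonempty → B ∉ T → (l0 - R • m) (b B) < H B) := by
    intro R hR
    constructor
    · intro B hB hBA
      have hB' : B ∈ T.erase A := Finset.mem_erase.2 ⟨hBA.ne, hB⟩
      rw [hsmall R B (htop B hB') (hTA B hB).2, hl1 B hB']
    · intro B hBA hne hBT
      by_cases h : B ⊆ A'
      · rw [hsmall R B h hne]
        exact hl2 B h hne fun h => hBT (Finset.mem_of_mem_erase h)
      · rw [hval]
        exact hR B (by simp [hBA.subset, hne, h])
  by_cases hAT : A ∈ T
  · have hlim : Filter.Tendsto (fun x : ℝ => (l0 (b A) - x) / m (b A))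
        Filter.atBot Filter.atTop := by
      refine Filter.Tendsto.atTop_div_const hmA ?_
      refine Filter.tendsto_atTop.2 fun c => ?_
      filter_upwards [Filter.eventually_le_atBot (l0 (b A) - c)] with x hx
      linarith
    filter_upwards [hlim.eventually hev] with x hx
    refine ⟨_, (hfin _ hx).1, fun _ => ?_, (hfin _ hx).2, fun h => (h hAT).elim⟩
    rw [hval]; field_simp; ring
  · filter_upwards with x
    have h2 : ∀ᶠ R : ℝ in Filter.atTop, l0 (b A) - R * m (b A) < x := eventually_sub_mul_lt hmA
    obtain ⟨R, hR, hx⟩ := (hev.and h2).exists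
    exact ⟨_, (hfin R hR).1, fun h => (hAT h).elim, (hfin R hR).2, fun _ => by rw [hval]; exact hx⟩

/-- Heights depending only on the dimension which certify all chains of faces of the simplices
of a finite family. -/
theorem exists_chain_heights [FiniteDimensional ℝ E] {F : Set (Finset E)} (hfin : F.Finite)
    (hF : ∀ A ∈ F, AffineIndependent ℝ ((↑) : A → E)) (hne : ∀ A ∈ F, A.Nonempty)
    (hd : ∀ A ∈ F, ∀ B ⊆ A, B.Nonempty → B ∈ F) {b : Finset E → E}
    (hb : ∀ A ∈ F, PosComb A (b A)) :
    ∃ g : ℕ → ℝ, ∀ A ∈ F, ∀ T : Finset (Finset E), T.Nonempty →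
      (∀ B ∈ T, B ⊆ A ∧ B.Nonempty) → ChainFam T →
      ∃ l : E →ᵃ[ℝ] ℝ, (∀ B ∈ T, l (b B) = g B.card) ∧
        ∀ B ⊆ A, B.Nonempty → B ∉ T → l (b B) < g B.card := by
  suffices h : ∀ k : ℕ, ∃ g : ℕ → ℝ, ∀ A ∈ F, A.card ≤ k → ∀ T : Finset (Finset E), T.Nonempty →
      (∀ B ∈ T, B ⊆ A ∧ B.Nonempty) → ChainFam T →
      ∃ l : E →ᵃ[ℝ] ℝ, (∀ B ∈ T, l (b B) = g B.card) ∧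
        ∀ B ⊆ A, B.Nonempty → B ∉ T → l (b B) < g B.card by
    obtain ⟨k, hk⟩ : ∃ k, ∀ A ∈ F, A.card ≤ k :=
      ⟨hfin.toFinset.sup Finset.card, fun A hA =>
        Finset.le_sup (f := Finset.card) (by simpa using hA)⟩
    obtain ⟨g, hg⟩ := h k
    exact ⟨g, fun A hA => hg A hA (hk A hA)⟩
  intro k
  induction k with
  | zero =>
    refine ⟨0, fun A hA hk => ?_⟩
    have := (hne A hA).card_pos
    omega
  | succ k ih =>
    obtain ⟨g, hg⟩ := ih
    have hev : ∀ᶠ x : ℝ in Filter.atBot, ∀ A ∈ F, A.card = k + 1 → ∀ T ∈ A.powerset.powerset,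
        T.Nonempty → (∀ B ∈ T, B.Nonempty) → ChainFam T → ∃ l : E →ᵃ[ℝ] ℝ,
        (∀ B ∈ T, B ⊂ A → l (b B) = g B.card) ∧ (A ∈ T → l (b A) = x) ∧
        (∀ B ⊂ A, B.Nonempty → B ∉ T → l (b B) < g B.card) ∧ (A ∉ T → l (b A) < x) := by
      refine (Filter.eventually_all_finite hfin).2 fun A hA => ?_
      refine Filter.eventually_all.2 fun hAk => (Filter.eventually_all_finset _).2 fun T hT => ?_
      refine Filter.eventually_all.2 fun hTne => Filter.eventually_all.2 fun hTB =>
        Filter.eventually_all.2 fun hch => ?_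
      refine eventually_chain_heights (H := fun B => g B.card) (hF A hA) (hne A hA)
        (fun B hB hBne => hb B (hd A hA B hB hBne)) hTne (fun B hB => ⟨?_, hTB B hB⟩) hch ?_
      · simpa using Finset.mem_powerset.1 hT hB
      · intro A' hA' hA'ne T' hT' hTA' hch'
        refine hg A' (hd A hA A' hA'.subset hA'ne) ?_ T' hT' hTA' hch'
        have := Finset.card_lt_card hA'
        omega
    obtain ⟨x, hx⟩ := hev.exists
    have hup : ∀ B : Finset E, B.card ≤ k → Function.update g (k + 1) x B.card = g B.card :=
      fun B hB => Function.update_of_ne (by omega) _ _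
    refine ⟨Function.update g (k + 1) x, fun A hA hAk T hT hTA hch => ?_⟩
    rcases Nat.lt_or_ge A.card (k + 1) with hlt | hge
    · obtain ⟨l, hl1, hl2⟩ := hg A hA (by omega) T hT hTA hch
      have hle : ∀ B ⊆ A, B.card ≤ k := fun B hB => (Finset.card_le_card hB).trans (by omega)
      refine ⟨l, fun B hB => ?_, fun B hB hBne hBT => ?_⟩
      · rw [hup B (hle B (hTA B hB).1), hl1 B hB]
      · rw [hup B (hle B hB)]; exact hl2 B hB hBne hBT
    · have hAc : A.card = k + 1 := le_antisymm hAk hge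
      obtain ⟨l, hl1, hl2, hl3, hl4⟩ := hx A hA hAc T
        (by rw [Finset.mem_powerset]; exact fun B hB => Finset.mem_powerset.2 (hTA B hB).1) hT
        (fun B hB => (hTA B hB).2) hch
      have hle : ∀ B ⊂ A, B.card ≤ k := fun B hB => by
        have := Finset.card_lt_card hB
        omega
      refine ⟨l, fun B hB => ?_, fun B hB hBne hBT => ?_⟩
      · rcases (hTA B hB).1.eq_or_ssubset with rfl | h
        · rw [hAc, Function.update_self]; exact hl2 hB
        · rw [hup B (hle B h)]; exact hl1 B hB h
      · rcases hB.eq_or_ssubset with rfl | h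
        · rw [hAc, Function.update_self]; exact hl4 hBT
        · rw [hup B (hle B h)]; exact hl3 B h hBne hBT

/-! ### Derived subdivisions -/

/-- A positive combination of a family of points of a simplex, one of which is interior, is
interior. -/
theorem PosComb.trans {R A : Finset E} {y u : E} (hy : PosComb R y)
    (hR : ∀ v ∈ R, v ∈ convexHull ℝ (A : Set E)) (hu : u ∈ R) (huA : PosComb A u) :
    PosComb A y := by
  obtain ⟨a, ha0, ha1, rfl⟩ := hy
  have : ∀ v, ∃ c : E → ℝ, v ∈ R → (∀ p ∈ A, 0 ≤ c p) ∧ ∑ p ∈ A, c p = 1 ∧ ∑ p ∈ A, c p • p = v ∧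
      (v = u → ∀ p ∈ A, 0 < c p) := fun v => by
    by_cases hvu : v = u
    · obtain ⟨c, h0, h1, h2⟩ := huA
      exact ⟨c, fun _ => ⟨fun p hp => (h0 p hp).le, h1, h2.trans hvu.symm, fun _ => h0⟩⟩
    · by_cases hv : v ∈ R
      · obtain ⟨c, h0, h1, h2⟩ := Finset.mem_convexHull'.1 (hR v hv)
        exact ⟨c, fun _ => ⟨h0, h1, h2, fun h => (hvu h).elim⟩⟩
      · exact ⟨0, fun h => (hv h).elim⟩
  choose c hc using this
  refine ⟨fun p => ∑ v ∈ R, a v * c v p, fun p hp => ?_, ?_, ?_⟩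
  · exact Finset.sum_pos' (fun v hv => mul_nonneg (ha0 v hv).le ((hc v hv).1 p hp))
      ⟨u, hu, mul_pos (ha0 u hu) ((hc u hu).2.2.2 rfl p hp)⟩
  · rw [Finset.sum_comm, ← ha1]
    refine Finset.sum_congr rfl fun v hv => ?_
    rw [← Finset.mul_sum, (hc v hv).2.1, mul_one]
  · simp_rw [Finset.sum_smul, mul_smul]
    rw [Finset.sum_comm]
    refine Finset.sum_congr rfl fun v hv => ?_
    rw [← Finset.smul_sum, (hc v hv).2.2.1]

theorem injOn_of_posComb [FiniteDimensional ℝ E] {D : Geometry.SimplicialComplex ℝ E}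
    {b : Finset E → E} (hb : ∀ A ∈ D.faces, PosComb A (b A)) : InjOn b D.faces := by
  intro A hA B hB hAB
  exact (subset_of_mem_faces hA hB (hb A hA) (hAB ▸ (hb B hB).mem_convexHull)).antisymm
    (subset_of_mem_faces hB hA (hb B hB) (hAB ▸ (hb A hA).mem_convexHull))

theorem exists_chain_mem_convexHull {A : Finset E} {b : Finset E → E}
    (hb : ∀ B ⊆ A, B.Nonempty → PosComb B (b B)) {y : E} (hy : y ∈ convexHull ℝ (A : Set E)) :
    ∃ T : Finset (Finset E), T.Nonempty ∧ (∀ B ∈ T, B ⊆ A ∧ B.Nonempty) ∧ ChainFam T ∧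
      y ∈ convexHull ℝ (T.image b : Set E) := by
  induction A using Finset.strongInduction generalizing y with
  | H A ih =>
  have hAne : A.Nonempty := by
    by_contra h
    simp [Finset.not_nonempty_iff_eq_empty.1 h] at hy
  obtain ⟨c, hc0, hc1, hc2⟩ := hb A subset_rfl hAne
  obtain ⟨a, ha0, ha1, ha2⟩ := Finset.mem_convexHull'.1 hy
  obtain ⟨v, hv, hmin⟩ := Finset.exists_min_image A (fun v => a v / c v) hAne
  set t := a v / c v with ht
  have hge : ∀ u ∈ A, 0 ≤ a u - t * c u := fun u hu => by
    have := (le_div_iff₀ (hc0 u hu)).1 (hmin u hu)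
    linarith
  have ht0 : 0 ≤ t := div_nonneg (ha0 v hv) (hc0 v hv).le
  have hv0 : a v - t * c v = 0 := by
    rw [ht, div_mul_cancel₀ _ (hc0 v hv).ne', sub_self]
  have hsum : ∑ u ∈ A, (a u - t * c u) = 1 - t := by
    rw [Finset.sum_sub_distrib, ← Finset.mul_sum, ha1, hc1, mul_one]
  have hsum' : ∑ u ∈ A.erase v, (a u - t * c u) = 1 - t := by
    rw [← hsum, ← Finset.add_sum_erase A _ hv, hv0, zero_add]
  have hvec : ∑ u ∈ A.erase v, (a u - t * c u) • u = y - t • b A := by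
    rw [← ha2, ← hc2, Finset.smul_sum, ← Finset.sum_sub_distrib, ← Finset.add_sum_erase A _ hv]
    rw [smul_smul, ← sub_smul, hv0, zero_smul, zero_add]
    exact Finset.sum_congr rfl fun u _ => by rw [sub_smul, smul_smul]
  have ht1 : t ≤ 1 := by
    have := Finset.sum_nonneg hge
    linarith
  rcases ht1.eq_or_lt with ht1 | ht1
  · refine ⟨{A}, by simp, by simpa using hAne, by simp [ChainFam], ?_⟩
    have h0 : ∀ u ∈ A.erase v, a u - t * c u = 0 := by
      refine (Finset.sum_eq_zero_iff_of_nonneg fun u hu => hge u (Finset.mem_of_mem_erase hu)).1 ?_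
      rw [hsum', ht1, sub_self]
    rw [Finset.sum_eq_zero fun u hu => by rw [h0 u hu, zero_smul], ht1, one_smul] at hvec
    simp [sub_eq_zero.1 hvec.symm]
  · have hpos : 0 < 1 - t := by linarith
    have hz : (1 - t)⁻¹ • (y - t • b A) ∈ convexHull ℝ (A.erase v : Set E) := by
      refine Finset.mem_convexHull'.2 ⟨fun u => (1 - t)⁻¹ * (a u - t * c u), fun u hu => ?_, ?_, ?_⟩
      · exact mul_nonneg (by positivity) (hge u (Finset.mem_of_mem_erase hu))
      · rw [← Finset.mul_sum, hsum', inv_mul_cancel₀ hpos.ne']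
      · rw [← hvec, Finset.smul_sum]
        exact Finset.sum_congr rfl fun u _ => by rw [mul_smul]
    obtain ⟨T, hTne, hTB, hch, hzT⟩ := ih (A.erase v) (Finset.erase_ssubset hv)
      (fun B hB => hb B (hB.trans (Finset.erase_subset _ _))) hz
    have hTA : ∀ B ∈ T, B ⊆ A := fun B hB => (hTB B hB).1.trans (Finset.erase_subset _ _)
    refine ⟨insert A T, by simp, ?_, ?_, ?_⟩
    · intro B hB
      rcases Finset.mem_insert.1 hB with rfl | h
      · exact ⟨subset_rfl, hAne⟩
      · exact ⟨hTA B h, (hTB B h).2⟩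
    · intro B hB C hC
      rcases Finset.mem_insert.1 hB with hB | hB <;> rcases Finset.mem_insert.1 hC with hC | hC
      · exact Or.inl (hB.trans hC.symm).subset
      · exact Or.inr (hB ▸ hTA C hC)
      · exact Or.inl (hC ▸ hTA B hB)
      · exact hch B hB C hC
    · have h1 : b A ∈ convexHull ℝ ((insert A T).image b : Set E) :=
        subset_convexHull _ _ (by simp)
      have h2 := convexHull_mono (t := ((insert A T).image b : Set E)) (by
        exact_mod_cast Finset.image_subset_image (Finset.subset_insert A T)) hzT
      have := (convex_convexHull ℝ _) h1 h2 ht0 hpos.le (by ring)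
      rwa [smul_smul, mul_inv_cancel₀ hpos.ne', one_smul, add_sub_cancel] at this

/-- A finite complex has a derived subdivision with any prescribed interior points. -/
theorem exists_derived [FiniteDimensional ℝ E] {D : Geometry.SimplicialComplex ℝ E}
    (hD : D.faces.Finite) {b : Finset E → E} (hb : ∀ A ∈ D.faces, PosComb A (b A)) :
    ∃ D' : Geometry.SimplicialComplex ℝ E, D'.faces = {S | ∃ T : Finset (Finset E),
      ↑T ⊆ D.faces ∧ T.Nonempty ∧ ChainFam T ∧ S = T.image b} ∧
      D'.space = D.space ∧ IsDerivedSubdivision D' D := by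
  obtain ⟨g, hg⟩ := exists_chain_heights hD (fun A hA => D.indep hA)
    (fun A hA => D.nonempty_of_mem_faces hA) (fun A hA B hB hne => D.down_closed hA hB hne) hb
  have hinj := injOn_of_posComb hb
  set F : Set (Finset E) := {S | ∃ T : Finset (Finset E),
      ↑T ⊆ D.faces ∧ T.Nonempty ∧ ChainFam T ∧ S = T.image b} with hF
  have hdown : ∀ {T : Finset (Finset E)} {r : Finset E}, r ⊆ T.image b →
      r = (T.filter (b · ∈ r)).image b := fun {T r} hr => by
    ext y
    simp only [Finset.mem_image, Finset.mem_filter]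
    constructor
    · intro hy
      obtain ⟨B, hB, rfl⟩ := Finset.mem_image.1 (hr hy)
      exact ⟨B, ⟨hB, hy⟩, rfl⟩
    · rintro ⟨B, ⟨-, hB⟩, rfl⟩
      exact hB
  have hconv : ∀ {T : Finset (Finset E)} {A : Finset E}, ↑T ⊆ D.faces → (∀ B ∈ T, B ⊆ A) →
      ∀ v ∈ T.image b, v ∈ convexHull ℝ (A : Set E) := fun {T A} hT hTA v hv => by
    obtain ⟨B, hB, rfl⟩ := Finset.mem_image.1 hv
    exact convexHull_mono (by exact_mod_cast hTA B hB) (hb B (hT hB)).mem_convexHull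
  let D' : Geometry.SimplicialComplex ℝ E :=
    { faces := F
      isRelLowerSet_faces := by
        rintro S ⟨T, hT, hTne, hch, rfl⟩
        refine ⟨hTne.image b, fun r hr hrne => ⟨T.filter (b · ∈ r), ?_, ?_, ?_, hdown hr⟩⟩
        · exact fun B hB => hT (Finset.mem_filter.1 hB).1
        · rw [hdown hr] at hrne
          exact Finset.image_nonempty.1 hrne
        · exact hch.mono (Finset.filter_subset _ _)
      indep := by
        rintro S ⟨T, hT, hTne, hch, rfl⟩
        refine affineIndependent_of_cert (w := fun y => g (Function.invFunOn b D.faces y).card)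
          fun r hr hrne => ?_
        obtain ⟨A, hA, htop⟩ := hch.exists_top hTne
        have hw : ∀ B ∈ T, Function.invFunOn b D.faces (b B) = B := fun B hB =>
          hinj.leftInvOn_invFunOn (hT hB)
        obtain ⟨l, hl1, hl2⟩ := hg A (hT hA) (T.filter (b · ∈ r)) (by
            rw [hdown hr] at hrne
            exact Finset.image_nonempty.1 hrne)
          (fun B hB => ⟨htop B (Finset.mem_filter.1 hB).1,
            D.nonempty_of_mem_faces (hT (Finset.mem_filter.1 hB).1)⟩)
          (hch.mono (Finset.filter_subset _ _))
        refine ⟨l, fun v hv => ?_, fun v hv hvr => ?_⟩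
        · obtain ⟨B, hB, rfl⟩ := Finset.mem_image.1 (hr hv)
          beta_reduce
          rw [hw B hB]
          exact hl1 B (Finset.mem_filter.2 ⟨hB, hv⟩)
        · obtain ⟨B, hB, rfl⟩ := Finset.mem_image.1 hv
          beta_reduce
          rw [hw B hB]
          exact hl2 B (htop B hB) (D.nonempty_of_mem_faces (hT hB))
            fun h => hvr (Finset.mem_filter.1 h).2
      inter_subset_convexHull := by
        rintro S S' ⟨T, hT, hTne, hch, rfl⟩ ⟨T', hT', hTne', hch', rfl⟩ y ⟨hy, hy'⟩
        obtain ⟨R, hR, hRy⟩ := exists_posComb_of_mem_convexHull hy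
        obtain ⟨R', hR', hRy'⟩ := exists_posComb_of_mem_convexHull hy'
        have key : ∀ {T : Finset (Finset E)} {R : Finset E}, ↑T ⊆ D.faces → ChainFam T →
            R ⊆ T.image b → PosComb R y → ∃ T₁ ⊆ T, ∃ A ∈ T₁, R = T₁.image b ∧ ChainFam T₁ ∧
              (∀ B ∈ T₁, B ⊆ A) ∧ PosComb A y := by
          intro T R hT hch hR hRy
          have hRne := hRy.nonempty
          rw [hdown hR] at hRne
          have hc := hch.mono (Finset.filter_subset (b · ∈ R) T)
          obtain ⟨A, hA, htop⟩ := hc.exists_top (Finset.image_nonempty.1 hRne)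
          have hA' := Finset.mem_filter.1 hA
          refine ⟨_, Finset.filter_subset _ _, A, hA, hdown hR, hc, htop, ?_⟩
          refine hRy.trans (fun v hv => ?_) hA'.2 (hb A (hT hA'.1))
          rw [hdown hR] at hv
          exact hconv (fun B hB => hT (Finset.mem_filter.1 hB).1) htop v hv
        obtain ⟨T₁, hT₁, A, hA, rfl, hc, htop, hAy⟩ := key hT hch hR hRy
        obtain ⟨T₂, hT₂, A', hA', rfl, hc', htop', hAy'⟩ := key hT' hch' hR' hRy'
        have hAD := hT (hT₁ hA)
        have hAD' := hT' (hT₂ hA')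
        obtain rfl : A = A' := (subset_of_mem_faces hAD hAD' hAy hAy'.mem_convexHull).antisymm
          (subset_of_mem_faces hAD' hAD hAy' hAy.mem_convexHull)
        obtain ⟨l, hl1, hl2⟩ := hg A hAD T₁ ⟨A, hA⟩
          (fun B hB => ⟨htop B hB, D.nonempty_of_mem_faces (hT (hT₁ hB))⟩) hc
        obtain ⟨l', hl1', hl2'⟩ := hg A hAD T₂ ⟨A, hA'⟩
          (fun B hB => ⟨htop' B hB, D.nonempty_of_mem_faces (hT' (hT₂ hB))⟩) hc'
        have hle : ∀ v ∈ T₁.image b, l' v ≤ l v := fun v hv => by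
          obtain ⟨B, hB, rfl⟩ := Finset.mem_image.1 hv
          rw [hl1 B hB]
          by_cases h : B ∈ T₂
          · exact (hl1' B h).le
          · exact (hl2' B (htop B hB) (D.nonempty_of_mem_faces (hT (hT₁ hB))) h).le
        have hle' : ∀ v ∈ T₂.image b, l v ≤ l' v := fun v hv => by
          obtain ⟨B, hB, rfl⟩ := Finset.mem_image.1 hv
          rw [hl1' B hB]
          by_cases h : B ∈ T₁
          · exact (hl1 B h).le
          · exact (hl2 B (htop' B hB) (D.nonempty_of_mem_faces (hT' (hT₂ hB))) h).le
        have hsub : T₁ ⊆ T₂ := by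
          intro B hB
          by_contra hB2
          have h1 := hRy.lt_of_forall_le hle (Finset.mem_image_of_mem b hB) (by
            rw [hl1 B hB]
            exact hl2' B (htop B hB) (D.nonempty_of_mem_faces (hT (hT₁ hB))) hB2)
          have h2 := hRy'.le_of_forall_le hle'
          linarith
        refine convexHull_mono ?_ hRy.mem_convexHull
        exact subset_inter (by exact_mod_cast Finset.image_subset_image hT₁)
          (by exact_mod_cast Finset.image_subset_image (hsub.trans hT₂)) }
  refine ⟨D', rfl, ?_, b, fun s hs => (hb s hs).mem_intrinsicInterior (D.indep hs), ?_⟩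
  · apply Subset.antisymm
    · intro y hy
      obtain ⟨S, ⟨T, hT, hTne, hch, rfl⟩, hyS⟩ := Geometry.SimplicialComplex.mem_space_iff.1 hy
      obtain ⟨A, hA, htop⟩ := hch.exists_top hTne
      refine D.convexHull_subset_space (hT hA) ?_
      exact convexHull_min (fun v hv => hconv hT htop v hv) (convex_convexHull ℝ _) hyS
    · intro y hy
      obtain ⟨A, hA, hyA⟩ := Geometry.SimplicialComplex.mem_space_iff.1 hy
      obtain ⟨T, hTne, hTA, hch, hyT⟩ := exists_chain_mem_convexHull
        (fun B hB hne => hb B (D.down_closed hA hB hne)) hyA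
      exact Geometry.SimplicialComplex.mem_space_iff.2 ⟨T.image b,
        ⟨T, fun B hB => D.down_closed hA (hTA B hB).1 (hTA B hB).2, hTne, hch, rfl⟩, hyT⟩
  · rfl

/-! ### Derived subdivisions adapted to hyperplanes -/

theorem sum_smul_affine_apply {ι : Type*} (s : Finset ι) (r : ι → ℝ) (c : ι → E →ᵃ[ℝ] ℝ) (y : E) :
    (∑ u ∈ s, r u • c u) y = ∑ u ∈ s, r u * c u y := by
  induction s using Finset.induction_on with
  | empty => simp
  | insert a s' ha ih => rw [Finset.sum_insert ha, Finset.sum_insert ha, ← ih]; simp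

theorem affine_lineMap (l : E →ᵃ[ℝ] ℝ) (y z : E) (θ : ℝ) :
    l ((1 - θ) • y + θ • z) = (1 - θ) * l y + θ * l z := by
  have h : ∀ y, l y = l.linear y + l 0 := fun y => by
    have := congrFun l.decomp y
    simpa using this
  rw [h, h y, h z, map_add, map_smul, map_smul, smul_eq_mul, smul_eq_mul]
  ring

theorem exists_posComb_eq_zero {A : Finset E} {y z : E} (hy : PosComb A y)
    (hz : z ∈ convexHull ℝ (A : Set E)) {h : E →ᵃ[ℝ] ℝ} (hyz : h y * h z < 0) :
    ∃ p, PosComb A p ∧ h p = 0 := by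
  have hne : h y - h z ≠ 0 := fun h0 => by
    rw [sub_eq_zero.1 h0] at hyz
    nlinarith [mul_self_nonneg (h z)]
  have hθ : 0 < h y / (h y - h z) ∧ h y / (h y - h z) < 1 := by
    rcases mul_neg_iff.1 hyz with ⟨h1, h2⟩ | ⟨h1, h2⟩
    · have : 0 < h y - h z := by linarith
      exact ⟨by positivity, (div_lt_one this).2 (by linarith)⟩
    · have : h y - h z < 0 := by linarith
      exact ⟨div_pos_of_neg_of_neg h1 this, (div_lt_one_of_neg this).2 (by linarith)⟩
  refine ⟨_, hy.lineMap hz subset_rfl hθ.1.le hθ.2, ?_⟩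
  rw [affine_lineMap]
  field_simp
  ring

/-- A choice of interior points lying on a given hyperplane whenever possible. -/
theorem exists_adapted (h : E →ᵃ[ℝ] ℝ) : ∃ b : Finset E → E, ∀ A : Finset E, A.Nonempty →
    PosComb A (b A) ∧ (h (b A) ≠ 0 → ∀ p, PosComb A p → h p ≠ 0) := by
  have : ∀ A : Finset E, ∃ y, A.Nonempty →
      PosComb A y ∧ (h y ≠ 0 → ∀ p, PosComb A p → h p ≠ 0) := fun A => by
    by_cases hA : ∃ p, PosComb A p ∧ h p = 0
    · obtain ⟨p, hp, h0⟩ := hA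
      exact ⟨p, fun _ => ⟨hp, fun h => (h h0).elim⟩⟩
    · by_cases hne : A.Nonempty
      · obtain ⟨y, hy⟩ := exists_posComb hne
        exact ⟨y, fun _ => ⟨hy, fun _ p hp h0 => hA ⟨p, hp, h0⟩⟩⟩
      · exact ⟨0, fun h => (hne h).elim⟩
  choose b hb using this
  exact ⟨b, hb⟩

/-- `h` has weakly constant sign on `s`. -/
def WeakSign (h : E →ᵃ[ℝ] ℝ) (s : Finset E) : Prop :=
  (∀ u ∈ s, 0 ≤ h u) ∨ ∀ u ∈ s, h u ≤ 0

theorem WeakSign.image {h : E →ᵃ[ℝ] ℝ} {A s : Finset E} (hA : WeakSign h A)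
    (hs : ∀ v ∈ s, v ∈ convexHull ℝ (A : Set E)) : WeakSign h s := by
  rcases hA with hA | hA
  · left
    intro v hv
    simpa using le_of_mem_convexHull (hs v hv) (l := AffineMap.const ℝ E (0 : ℝ)) (l' := h)
      fun u hu => by simpa using hA u hu
  · right
    intro v hv
    simpa using le_of_mem_convexHull (hs v hv) (l' := AffineMap.const ℝ E (0 : ℝ)) (l := h)
      fun u hu => by simpa using hA u hu

theorem weakSign_of_adapted {h : E →ᵃ[ℝ] ℝ} {b : Finset E → E}
    (hb : ∀ A : Finset E, A.Nonempty →
      PosComb A (b A) ∧ (h (b A) ≠ 0 → ∀ p, PosComb A p → h p ≠ 0))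
    {T : Finset (Finset E)} (hT : ∀ B ∈ T, B.Nonempty) (hch : ChainFam T) :
    WeakSign h (T.image b) := by
  have key : ∀ B ∈ T, ∀ C ∈ T, B ⊆ C → ¬ h (b C) * h (b B) < 0 := by
    intro B hB C hC hBC hlt
    have hz := convexHull_mono (by exact_mod_cast hBC) (hb B (hT B hB)).1.mem_convexHull
    obtain ⟨p, hp, hp0⟩ := exists_posComb_eq_zero (hb C (hT C hC)).1 hz hlt
    exact (hb C (hT C hC)).2 (fun h0 => by simp [h0] at hlt) p hp hp0
  by_contra hcon
  simp only [WeakSign, Finset.mem_image, forall_exists_index, and_imp,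
    forall_apply_eq_imp_iff₂, not_or, not_forall, not_le] at hcon
  obtain ⟨⟨B, hB, hB0⟩, ⟨C, hC, hC0⟩⟩ := hcon
  rcases hch B hB C hC with hBC | hBC
  · exact key B hB C hC hBC (mul_neg_of_pos_of_neg hC0 hB0)
  · exact key C hC B hB hBC (mul_neg_of_neg_of_pos hB0 hC0)

/-- Finitely many functionals detecting membership in a simplex. -/
theorem exists_cut [FiniteDimensional ℝ E] {κ : Finset E}
    (hκ : AffineIndependent ℝ ((↑) : κ → E)) : ∃ G : Finset (E →ᵃ[ℝ] ℝ), ∀ (s : Finset E) (v : E),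
      (∀ u ∈ s, u ∈ convexHull ℝ (κ : Set E)) →
      (∀ g ∈ G, (∀ u ∈ s, 0 ≤ g u) → 0 ≤ g v) → (∀ g ∈ G, (∀ u ∈ s, g u = 0) → g v = 0) →
      v ∈ convexHull ℝ (κ : Set E) := by
  obtain ⟨t, c, hst, -, hc, h1, h2⟩ := exists_coords hκ
  refine ⟨t.image c, fun s v hs hpos hzero => ?_⟩
  have hz : ∀ u ∈ t, u ∉ κ → c u v = 0 := fun u hu huκ => by
    refine hzero _ (Finset.mem_image_of_mem c hu) fun y hy => ?_
    have := eq_of_mem_convexHull (hs y hy) (l := c u) (l' := AffineMap.const ℝ E (0 : ℝ))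
      fun v hv => by rw [hc u hu v (hst hv), if_neg (by rintro rfl; exact huκ hv)]; simp
    simpa using this
  refine Finset.mem_convexHull'.2 ⟨fun u => c u v, fun u hu => ?_, ?_, ?_⟩
  · refine hpos _ (Finset.mem_image_of_mem c (hst hu)) fun y hy => ?_
    have := le_of_mem_convexHull (hs y hy) (l' := c u) (l := AffineMap.const ℝ E (0 : ℝ))
      fun v hv => by rw [hc u (hst hu) v (hst hv)]; split_ifs <;> simp
    simpa using this
  · rw [← h1 v]
    exact Finset.sum_subset hst fun u hu huκ => hz u hu huκ
  · refine Eq.trans ?_ (h2 v)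
    exact Finset.sum_subset hst fun u hu huκ => by simp [hz u hu huκ]

/-- Simultaneous iterated derived subdivisions of two complexes and a common subcomplex, adapted
to the hyperplanes `H`, with heights certifying the simplices inside each original simplex. -/
structure Reg (C : Bool → Geometry.SimplicialComplex ℝ E) (L : Geometry.SimplicialComplex ℝ E)
    (H : Set (E →ᵃ[ℝ] ℝ)) (m : ℕ) (D : Bool → Geometry.SimplicialComplex ℝ E)
    (DL : Geometry.SimplicialComplex ℝ E) (f : Bool → E → ℝ) : Prop where
  finite : ∀ i, (D i).faces.Finite
  space : ∀ i, (D i).space = (C i).space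
  spaceL : DL.space = L.space
  sub : ∀ i, DL.faces ⊆ (D i).faces
  iter : ∀ i, IsIterDerived m (D i) (C i)
  iterL : IsIterDerived m DL L
  sign : ∀ h ∈ H, ∀ i, ∀ s ∈ (D i).faces, WeakSign h s
  agree : ∀ i j, ∀ v ∈ DL.vertices, f i v = f j v
  cert : ∀ i, ∀ s ∈ (D i).faces, ∃ κ ∈ (C i).faces, (∀ v ∈ s, v ∈ convexHull ℝ (κ : Set E)) ∧
    (s ∈ DL.faces → κ ∈ L.faces) ∧ ∃ l : E →ᵃ[ℝ] ℝ, (∀ v ∈ s, l v = f i v) ∧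
      ∀ v ∈ (D i).vertices, v ∈ convexHull ℝ (κ : Set E) → v ∉ s → l v < f i v

theorem Reg.base {C : Bool → Geometry.SimplicialComplex ℝ E} {L : Geometry.SimplicialComplex ℝ E}
    (hC : ∀ i, (C i).faces.Finite) (hL : ∀ i, L.faces ⊆ (C i).faces) :
    Reg C L ∅ 0 C L fun _ => 0 where
  finite := hC
  space := fun _ => rfl
  spaceL := rfl
  sub := hL
  iter := fun _ => rfl
  iterL := rfl
  sign := by simp
  agree := fun _ _ _ _ => rfl
  cert := fun i s hs => ⟨s, hs, fun v hv => subset_convexHull _ _ hv, id, 0, by simp,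
    fun v hv hvs hvs' => (hvs' (((C i).vertex_mem_convexHull_iff hv hs).1 hvs)).elim⟩

theorem Reg.step [FiniteDimensional ℝ E] {C : Bool → Geometry.SimplicialComplex ℝ E}
    {L : Geometry.SimplicialComplex ℝ E} {H : Set (E →ᵃ[ℝ] ℝ)} {m : ℕ}
    {D : Bool → Geometry.SimplicialComplex ℝ E} {DL : Geometry.SimplicialComplex ℝ E}
    {f : Bool → E → ℝ} (hR : Reg C L H m D DL f) (h : E →ᵃ[ℝ] ℝ) :
    ∃ D' DL' f', Reg C L (insert h H) (m + 1) D' DL' f' := by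
  obtain ⟨b, hb⟩ := exists_adapted h
  have hbD : ∀ i, ∀ A ∈ (D i).faces, PosComb A (b A) := fun i A hA =>
    (hb A ((D i).nonempty_of_mem_faces hA)).1
  choose D' hD'f hD's hD'd using fun i => exists_derived (hR.finite i) (hbD i)
  have hLfin : DL.faces.Finite := (hR.finite true).subset (hR.sub true)
  obtain ⟨DL', hL'f, hL's, hL'd⟩ := exists_derived hLfin
    fun A hA => hbD true A (hR.sub true hA)
  set F : Set (Finset E) := ⋃ i, (D i).faces with hF
  have hFfin : F.Finite := Set.finite_iUnion hR.finite
  have hmemF : ∀ {i A}, A ∈ (D i).faces → A ∈ F := fun {i A} hA => mem_iUnion.2 ⟨i, hA⟩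
  obtain ⟨g, hg⟩ := exists_chain_heights hFfin (b := b)
    (fun A hA => by obtain ⟨i, hi⟩ := mem_iUnion.1 hA; exact (D i).indep hi)
    (fun A hA => by obtain ⟨i, hi⟩ := mem_iUnion.1 hA; exact (D i).nonempty_of_mem_faces hi)
    (fun A hA B hB hne => by
      obtain ⟨i, hi⟩ := mem_iUnion.1 hA; exact hmemF ((D i).down_closed hi hB hne))
    (fun A hA => by obtain ⟨i, hi⟩ := mem_iUnion.1 hA; exact hbD i A hi)
  have hcert : ∀ i s, ∃ (κ : Finset E) (l : E →ᵃ[ℝ] ℝ), s ∈ (D i).faces → κ ∈ (C i).faces ∧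
      (∀ v ∈ s, v ∈ convexHull ℝ (κ : Set E)) ∧ (s ∈ DL.faces → κ ∈ L.faces) ∧
      (∀ v ∈ s, l v = f i v) ∧
      ∀ v ∈ (D i).vertices, v ∈ convexHull ℝ (κ : Set E) → v ∉ s → l v < f i v := fun i s => by
    by_cases hs : s ∈ (D i).faces
    · obtain ⟨κ, h1, h2, h3, l, h4, h5⟩ := hR.cert i s hs
      exact ⟨κ, l, fun _ => ⟨h1, h2, h3, h4, h5⟩⟩
    · exact ⟨∅, 0, fun h => (hs h).elim⟩
  choose κ lf hκ using hcert
  have hl2 : ∀ (A : Finset E) (T : Finset (Finset E)), ∃ l : E →ᵃ[ℝ] ℝ, A ∈ F → T.Nonempty →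
      (∀ B ∈ T, B ⊆ A ∧ B.Nonempty) → ChainFam T → (∀ B ∈ T, l (b B) = g B.card) ∧
        ∀ B ⊆ A, B.Nonempty → B ∉ T → l (b B) < g B.card := fun A T => by
    by_cases hh : A ∈ F ∧ T.Nonempty ∧ (∀ B ∈ T, B ⊆ A ∧ B.Nonempty) ∧ ChainFam T
    · obtain ⟨l, hl⟩ := hg A hh.1 T hh.2.1 hh.2.2.1 hh.2.2.2
      exact ⟨l, fun _ _ _ _ => hl⟩
    · exact ⟨0, fun h1 h2 h3 h4 => (hh ⟨h1, h2, h3, h4⟩).elim⟩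
  choose l2 hl2 using hl2
  obtain ⟨ε, hε, hε0⟩ : ∃ ε : ℝ, (∀ i, ∀ A ∈ F, ∀ T : Finset (Finset E), (T : Set (Finset E)) ⊆ F →
      ∀ B ∈ F, lf i A (b B) < lf i B (b B) →
      lf i A (b B) + ε * l2 A T (b B) < lf i B (b B) + ε * g B.card) ∧ 0 < ε := by
    let W : Set (Bool × Finset E × Finset (Finset E) × Finset E) :=
      {p | p ∈ (univ : Set Bool) ×ˢ F ×ˢ (hFfin.toFinset.powerset : Set (Finset (Finset E))) ×ˢ F ∧
        lf p.1 p.2.1 (b p.2.2.2) < lf p.1 p.2.2.2 (b p.2.2.2)}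
    have hW : W.Finite := (Set.Finite.prod Set.finite_univ (hFfin.prod
      ((Finset.finite_toSet _).prod hFfin))).subset fun p hp => hp.1
    have := eventually_add_mul_lt hW (a := fun p => lf p.1 p.2.1 (b p.2.2.2))
      (b := fun p => l2 p.2.1 p.2.2.1 (b p.2.2.2) - g p.2.2.2.card)
      (c := fun p => lf p.1 p.2.2.2 (b p.2.2.2)) fun p hp => hp.2
    obtain ⟨ε, hε, hpos⟩ := (this.and self_mem_nhdsWithin).exists
    refine ⟨ε, fun i A hA T hT B hB hlt => ?_, hpos⟩
    have := hε (i, A, T, B) ⟨⟨mem_univ _, hA, by simpa [Set.Finite.subset_toFinset] using hT, hB⟩, hlt⟩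
    simp only at this
    linarith
  have hinv : ∀ i, ∀ A ∈ (D i).faces, Function.invFunOn b (D i).faces (b A) = A := fun i A hA =>
    (injOn_of_posComb (hbD i)).leftInvOn_invFunOn hA
  have hvert : ∀ {X Y : Geometry.SimplicialComplex ℝ E}, Y.faces = {S | ∃ T : Finset (Finset E),
      ↑T ⊆ X.faces ∧ T.Nonempty ∧ ChainFam T ∧ S = T.image b} → ∀ v ∈ Y.vertices,
      ∃ B ∈ X.faces, v = b B := fun {X Y} hXY v hv => by
    rw [Geometry.SimplicialComplex.mem_vertices, hXY] at hv
    obtain ⟨T, hT, ⟨B, hB⟩, -, hv⟩ := hv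
    have : b B ∈ ({v} : Finset E) := hv ▸ Finset.mem_image_of_mem b hB
    exact ⟨B, hT hB, (Finset.mem_singleton.1 this).symm⟩
  let f' : Bool → E → ℝ := fun i y => lf i (Function.invFunOn b (D i).faces y) y +
    ε * g (Function.invFunOn b (D i).faces y).card
  have hf' : ∀ i, ∀ A ∈ (D i).faces, f' i (b A) = lf i A (b A) + ε * g A.card := fun i A hA => by
    simp only [f', hinv i A hA]
  refine ⟨D', DL', f', ⟨fun i => ?_, fun i => (hD's i).trans (hR.space i), hL's.trans hR.spaceL,
    fun i => ?_, fun i => ⟨D i, hR.iter i, hD'd i⟩, ⟨DL, hR.iterL, hL'd⟩, ?_, ?_, ?_⟩⟩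
  · rw [hD'f i]
    refine ((Finset.finite_toSet (hFfin.toFinset.powerset)).image (Finset.image b)).subset ?_
    rintro S ⟨T, hT, -, -, rfl⟩
    refine ⟨T, ?_, rfl⟩
    simp only [Finset.coe_powerset, mem_preimage, mem_powerset_iff, Set.Finite.coe_toFinset]
    exact hT.trans fun A hA => hmemF hA
  · rw [hL'f, hD'f i]
    rintro S ⟨T, hT, h1, h2, h3⟩
    exact ⟨T, hT.trans (hR.sub i), h1, h2, h3⟩
  · intro h' hh' i S hS
    rw [hD'f i] at hS
    obtain ⟨T, hT, hTne, hch, rfl⟩ := hS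
    rcases hh' with rfl | hh'
    · exact weakSign_of_adapted hb (fun B hB => (D i).nonempty_of_mem_faces (hT hB)) hch
    · obtain ⟨A, hA, htop⟩ := hch.exists_top hTne
      refine (hR.sign h' hh' i A (hT hA)).image fun v hv => ?_
      obtain ⟨B, hB, rfl⟩ := Finset.mem_image.1 hv
      exact convexHull_mono (by exact_mod_cast htop B hB) (hbD i B (hT hB)).mem_convexHull
  · intro i j v hv
    obtain ⟨B, hB, rfl⟩ := hvert hL'f v hv
    rw [hf' i B (hR.sub i hB), hf' j B (hR.sub j hB)]
    congr 1
    refine eq_of_mem_convexHull (hbD i B (hR.sub i hB)).mem_convexHull fun v hv => ?_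
    rw [(hκ i B (hR.sub i hB)).2.2.2.1 v hv, (hκ j B (hR.sub j hB)).2.2.2.1 v hv]
    exact hR.agree i j v (DL.down_closed hB (by simpa using hv) (by simp))
  · intro i S hS
    obtain ⟨T, hT, hTL, hTne, hch, rfl⟩ : ∃ T : Finset (Finset E), ↑T ⊆ (D i).faces ∧
        (S ∈ DL'.faces → ↑T ⊆ DL.faces) ∧ T.Nonempty ∧ ChainFam T ∧ S = T.image b := by
      by_cases hSL : S ∈ DL'.faces
      · rw [hL'f] at hSL
        obtain ⟨T, h0, h1, h2, h3⟩ := hSL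
        exact ⟨T, h0.trans (hR.sub i), fun _ => h0, h1, h2, h3⟩
      · rw [hD'f i] at hS
        obtain ⟨T, h0, h1, h2, h3⟩ := hS
        exact ⟨T, h0, fun h => (hSL h).elim, h1, h2, h3⟩
    obtain ⟨A, hA, htop⟩ := hch.exists_top hTne
    have hAD := hT hA
    obtain ⟨hκ1, hκ2, hκ3, hκ4, hκ5⟩ := hκ i A hAD
    have hl := hl2 A T (hmemF hAD) hTne
      (fun B hB => ⟨htop B hB, (D i).nonempty_of_mem_faces (hT hB)⟩) hch
    have heq : ∀ B ∈ (D i).faces, B ⊆ A → lf i A (b B) = lf i B (b B) := fun B hB hBA =>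
      eq_of_mem_convexHull (hbD i B hB).mem_convexHull fun v hv => by
        rw [hκ4 v (hBA hv), (hκ i B hB).2.2.2.1 v hv]
    refine ⟨κ i A, hκ1, fun v hv => ?_, fun hS => hκ3 (hTL hS hA), lf i A + ε • l2 A T,
      fun v hv => ?_, fun v hv hvκ hvS => ?_⟩
    · obtain ⟨B, hB, rfl⟩ := Finset.mem_image.1 hv
      exact convexHull_min (fun v hv => hκ2 v hv) (convex_convexHull ℝ _)
        (convexHull_mono (by exact_mod_cast htop B hB) (hbD i B (hT hB)).mem_convexHull)
    · obtain ⟨B, hB, rfl⟩ := Finset.mem_image.1 hv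
      rw [hf' i B (hT hB), ← heq B (hT hB) (htop B hB), ← hl.1 B hB]
      simp
    · obtain ⟨B, hB, rfl⟩ := hvert (hD'f i) v hv
      have hBT : B ∉ T := fun h => hvS (Finset.mem_image_of_mem b h)
      rw [hf' i B hB]
      have hval : (lf i A + ε • l2 A T) (b B) = lf i A (b B) + ε * l2 A T (b B) := by simp
      rw [hval]
      by_cases hBA : B ⊆ A
      · rw [heq B hB hBA]
        have := hl.2 B hBA ((D i).nonempty_of_mem_faces hB) hBT
        have := mul_lt_mul_of_pos_left this hε0
        linarith
      · obtain ⟨u, hu, huA⟩ := Finset.not_subset.1 hBA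
        have hBκ : ∀ v ∈ B, v ∈ convexHull ℝ (κ i A : Set E) := by
          have hbB : b B ∈ convexHull ℝ (κ i B : Set E) :=
            convexHull_min (fun v hv => (hκ i B hB).2.1 v hv) (convex_convexHull ℝ _)
              (hbD i B hB).mem_convexHull
          have hmem := (C i).inter_subset_convexHull (hκ i B hB).1 hκ1 ⟨hbB, hvκ⟩
          rw [← Finset.coe_inter] at hmem
          intro v hv
          exact convexHull_mono (by exact_mod_cast Finset.inter_subset_right)
            (mem_convexHull_of_posComb ((C i).indep (hκ i B hB).1) Finset.inter_subset_left
              (hκ i B hB).2.1 (hbD i B hB) hmem hv)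
        have hvv : ∀ v ∈ B, v ∈ (D i).vertices := fun v hv =>
          (D i).down_closed hB (by simpa using hv) (by simp)
        refine hε i A (hmemF hAD) T (fun B hB => hmemF (hT hB)) B (hmemF hB) ?_
        refine (hbD i B hB).lt_of_forall_le (fun v hv => ?_) hu ?_
        · rw [(hκ i B hB).2.2.2.1 v hv]
          by_cases hvA : v ∈ A
          · exact (hκ4 v hvA).le
          · exact (hκ5 v (hvv v hv) (hBκ v hv) hvA).le
        · rw [(hκ i B hB).2.2.2.1 u hu]
          exact hκ5 u (hvv u hu) (hBκ u hu) huA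

theorem exists_reg [FiniteDimensional ℝ E] {C : Bool → Geometry.SimplicialComplex ℝ E}
    {L : Geometry.SimplicialComplex ℝ E} (hC : ∀ i, (C i).faces.Finite)
    (hL : ∀ i, L.faces ⊆ (C i).faces) (H : Finset (E →ᵃ[ℝ] ℝ)) :
    ∃ m D DL f, Reg C L H m D DL f := by
  induction H using Finset.induction_on with
  | empty => exact ⟨0, C, L, _, by simpa using Reg.base hC hL⟩
  | insert h H _ ih =>
    obtain ⟨m, D, DL, f, hR⟩ := ih
    obtain ⟨D', DL', f', hR'⟩ := hR.step h
    exact ⟨m + 1, D', DL', f', by simpa using hR'⟩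

/-- The sign with which `g` is counted on a set on which it has weakly constant sign. -/
noncomputable def signOn (s : Finset E) (g : E →ᵃ[ℝ] ℝ) : ℝ :=
  if ∀ u ∈ s, g u = 0 then 0 else if ∀ u ∈ s, 0 ≤ g u then 1 else -1

theorem signOn_mul_le (s : Finset E) (g : E →ᵃ[ℝ] ℝ) (v : E) : signOn s g * g v ≤ |g v| := by
  unfold signOn
  split_ifs
  · simp
  · simpa using le_abs_self _
  · simpa using neg_le_abs _

theorem signOn_mul_eq {s : Finset E} {g : E →ᵃ[ℝ] ℝ} (hs : WeakSign g s) {v : E} (hv : v ∈ s) :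
    signOn s g * g v = |g v| := by
  unfold signOn
  split_ifs with h1 h2
  · simp [h1 v hv]
  · rw [one_mul, abs_of_nonneg (h2 v hv)]
  · rcases hs with h | h
    · exact (h2 h).elim
    · rw [neg_one_mul, abs_of_nonpos (h v hv)]

theorem eq_zero_of_signOn {s : Finset E} {g : E →ᵃ[ℝ] ℝ} {v : E}
    (h : signOn s g * g v = |g v|) (hs : ∀ u ∈ s, g u = 0) : g v = 0 := by
  rw [signOn, if_pos hs, zero_mul] at h
  exact abs_eq_zero.1 h.symm

theorem nonneg_of_signOn {s : Finset E} {g : E →ᵃ[ℝ] ℝ} {v : E}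
    (h : signOn s g * g v = |g v|) (hs : ∀ u ∈ s, 0 ≤ g u) : 0 ≤ g v := by
  by_cases h0 : ∀ u ∈ s, g u = 0
  · exact (eq_zero_of_signOn h h0).ge
  · rw [signOn, if_neg h0, if_pos hs, one_mul] at h
    rw [h]; exact abs_nonneg _

/-- Two complexes with a common subcomplex have iterated derived subdivisions which are lower
envelopes of heights, with a common certificate for the simplices of the subcomplex. -/
theorem exists_certified [FiniteDimensional ℝ E] {C : Bool → Geometry.SimplicialComplex ℝ E}
    {L : Geometry.SimplicialComplex ℝ E} (hC : ∀ i, (C i).faces.Finite)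
    (hL : ∀ i, L.faces ⊆ (C i).faces) :
    ∃ (m : ℕ) (D : Bool → Geometry.SimplicialComplex ℝ E) (DL : Geometry.SimplicialComplex ℝ E)
      (V : Bool → Finset E) (w : Bool → E → ℝ),
      (∀ i, IsIterDerived m (D i) (C i)) ∧ IsIterDerived m DL L ∧ (∀ i, DL.faces ⊆ (D i).faces) ∧
      (∀ i, (D i).space = (C i).space) ∧ DL.space = L.space ∧
      (∀ i, Certified (V i) (w i) (D i)) ∧
      (∀ i j, ∀ v ∈ DL.vertices, w i v = w j v) ∧
      ∃ l : Finset E → E →ᵃ[ℝ] ℝ, ∀ s ∈ DL.faces, ∀ i, (∀ v ∈ s, l s v = w i v) ∧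
        ∀ v ∈ V i, v ∉ s → l s v < w i v := by
  have hcut : ∀ κ : Finset E, ∃ G : Finset (E →ᵃ[ℝ] ℝ), AffineIndependent ℝ ((↑) : κ → E) →
      ∀ (s : Finset E) (v : E), (∀ u ∈ s, u ∈ convexHull ℝ (κ : Set E)) →
      (∀ g ∈ G, (∀ u ∈ s, 0 ≤ g u) → 0 ≤ g v) → (∀ g ∈ G, (∀ u ∈ s, g u = 0) → g v = 0) →
      v ∈ convexHull ℝ (κ : Set E) := fun κ => by
    by_cases hκ : AffineIndependent ℝ ((↑) : κ → E)
    · obtain ⟨G, hG⟩ := exists_cut hκ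
      exact ⟨G, fun _ => hG⟩
    · exact ⟨∅, fun h => (hκ h).elim⟩
  choose G hG using hcut
  have hCfin : (⋃ i, (C i).faces).Finite := Set.finite_iUnion hC
  let H : Finset (E →ᵃ[ℝ] ℝ) := hCfin.toFinset.biUnion G
  have hGH : ∀ i, ∀ κ ∈ (C i).faces, G κ ⊆ H := fun i κ hκ =>
    Finset.subset_biUnion_of_mem G (hCfin.mem_toFinset.2 (mem_iUnion.2 ⟨i, hκ⟩))
  obtain ⟨m, D, DL, f, hR⟩ := exists_reg hC hL H
  have hVfin : ∀ i, (D i).vertices.Finite := fun i =>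
    ((hR.finite i).preimage (Finset.singleton_injective.injOn)).subset fun v hv => hv
  let V : Bool → Finset E := fun i => (hVfin i).toFinset
  have hV : ∀ {i v}, v ∈ V i ↔ v ∈ (D i).vertices := by simp [V]
  have hsub : ∀ i, ∀ s ∈ (D i).faces, s ⊆ V i := fun i s hs v hv =>
    hV.2 ((D i).down_closed hs (by simpa using hv) (by simp))
  have hcert : ∀ i s, ∃ (κ : Finset E) (l : E →ᵃ[ℝ] ℝ), s ∈ (D i).faces → κ ∈ (C i).faces ∧
      (∀ v ∈ s, v ∈ convexHull ℝ (κ : Set E)) ∧ (s ∈ DL.faces → κ ∈ L.faces) ∧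
      (∀ v ∈ s, l v = f i v) ∧
      ∀ v ∈ (D i).vertices, v ∈ convexHull ℝ (κ : Set E) → v ∉ s → l v < f i v := fun i s => by
    by_cases hs : s ∈ (D i).faces
    · obtain ⟨κ, h1, h2, h3, l, h4, h5⟩ := hR.cert i s hs
      exact ⟨κ, l, fun _ => ⟨h1, h2, h3, h4, h5⟩⟩
    · exact ⟨∅, 0, fun h => (hs h).elim⟩
  choose κ lf hκ using hcert
  let l0 : Finset E → E →ᵃ[ℝ] ℝ := fun s => ∑ g ∈ H, signOn s g • g
  have hl0 : ∀ s v, l0 s v = ∑ g ∈ H, signOn s g * g v := fun s v =>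
    sum_smul_affine_apply H (fun g => signOn s g) id v
  let W : E → ℝ := fun v => ∑ g ∈ H, |g v|
  have hle : ∀ s v, l0 s v ≤ W v := fun s v => by
    rw [hl0]
    exact Finset.sum_le_sum fun g _ => signOn_mul_le s g v
  have hmem : ∀ i, ∀ s ∈ (D i).faces, ∀ v, l0 s v = W v → v ∈ convexHull ℝ (κ i s : Set E) := by
    intro i s hs v hv
    rw [hl0] at hv
    have := (Finset.sum_eq_sum_iff_of_le fun g _ => signOn_mul_le s g v).1 hv
    obtain ⟨h1, h2, -⟩ := hκ i s hs
    have hsubH := hGH i _ h1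
    exact hG _ ((C i).indep h1) s v h2 (fun g hg hs => nonneg_of_signOn (this g (hsubH hg)) hs)
      (fun g hg hs => eq_zero_of_signOn (this g (hsubH hg)) hs)
  have hon : ∀ i, ∀ s ∈ (D i).faces, ∀ v ∈ s, l0 s v = W v := fun i s hs v hv => by
    rw [hl0]
    exact Finset.sum_congr rfl fun g hg => signOn_mul_eq (hR.sign g hg i s hs) hv
  obtain ⟨ε, hε, hε0⟩ : ∃ ε : ℝ, (∀ i, ∀ s ∈ (D i).faces, ∀ j, ∀ v ∈ V j, l0 s v < W v →
      l0 s v + ε * lf i s v < W v + ε * f j v) ∧ 0 < ε := by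
    let X : Set (Bool × Finset E × Bool × E) :=
      {p | p ∈ (univ : Set Bool) ×ˢ (⋃ i, (D i).faces) ×ˢ (univ : Set Bool) ×ˢ
        (⋃ i, (D i).vertices) ∧ l0 p.2.1 p.2.2.2 < W p.2.2.2}
    have hX : X.Finite := (Set.Finite.prod Set.finite_univ ((Set.finite_iUnion hR.finite).prod
      (Set.finite_univ.prod (Set.finite_iUnion hVfin)))).subset fun p hp => hp.1
    have := eventually_add_mul_lt hX (a := fun p => l0 p.2.1 p.2.2.2)
      (b := fun p => lf p.1 p.2.1 p.2.2.2 - f p.2.2.1 p.2.2.2)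
      (c := fun p => W p.2.2.2) fun p hp => hp.2
    obtain ⟨ε, hε, hpos⟩ := (this.and self_mem_nhdsWithin).exists
    refine ⟨ε, fun i s hs j v hv hlt => ?_, hpos⟩
    have := hε (i, s, j, v) ⟨⟨mem_univ _, mem_iUnion.2 ⟨i, hs⟩, mem_univ _,
      mem_iUnion.2 ⟨j, hV.1 hv⟩⟩, hlt⟩
    simp only at this
    linarith
  let w : Bool → E → ℝ := fun i v => W v + ε * f i v
  have hval : ∀ i s v, (l0 s + ε • lf i s) v = l0 s v + ε * lf i s v := fun i s v => by simp
  have hc1 : ∀ i, ∀ s ∈ (D i).faces, ∀ v ∈ s, (l0 s + ε • lf i s) v = w i v := fun i s hs v hv => by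
    rw [hval, hon i s hs v hv, (hκ i s hs).2.2.2.1 v hv]
  have hc2 : ∀ i, ∀ s ∈ (D i).faces, ∀ j, ∀ v ∈ V j,
      (v ∈ convexHull ℝ (κ i s : Set E) → lf i s v < f j v) → (l0 s + ε • lf i s) v < w j v := by
    intro i s hs j v hv h
    rw [hval]
    rcases (hle s v).eq_or_lt with heq | hlt
    · have := mul_lt_mul_of_pos_left (h (hmem i s hs v heq)) hε0
      simp only [w]
      linarith
    · exact hε i s hs j v hv hlt
  refine ⟨m, D, DL, V, w, hR.iter, hR.iterL, hR.sub, hR.space, hR.spaceL, fun i => ⟨hsub i, ?_⟩,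
    fun i j v hv => ?_, fun s => l0 s + ε • lf true s, ?_⟩
  · exact fun s hs => ⟨_, hc1 i s hs, fun v hv hvs => hc2 i s hs i v hv fun h =>
      (hκ i s hs).2.2.2.2 v (hV.1 hv) h hvs⟩
  · simp only [w, hR.agree i j v hv]
  · intro s hs j
    have hsT := hR.sub true hs
    have hagree : ∀ v ∈ s, w true v = w j v := fun v hv => by
      simp only [w, hR.agree true j v (DL.down_closed hs (by simpa using hv) (by simp))]
    refine ⟨fun v hv => (hc1 true s hsT v hv).trans (hagree v hv), fun v hv hvs => ?_⟩
    refine hc2 true s hsT j v hv fun hvκ => ?_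
    have hvL : v ∈ DL.space := by
      rw [hR.spaceL]
      exact L.convexHull_subset_space ((hκ true s hsT).2.2.1 hs) hvκ
    obtain ⟨t, ht, hvt⟩ := Geometry.SimplicialComplex.mem_space_iff.1 hvL
    have hvt' := ((D j).vertex_mem_convexHull_iff (hV.1 hv) (hR.sub j ht)).1 hvt
    have hvDL : v ∈ DL.vertices := DL.down_closed ht (by simpa using hvt') (by simp)
    rw [hR.agree j true v hvDL]
    exact (hκ true s hsT).2.2.2.2 v (hR.sub true hvDL) hvκ hvs

/-! ### Flips -/

/-- If a point is interior to two disjoint faces `A`, `B` of `A ∪ B`, then the convex hull of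
`A ∪ B` is covered by the faces omitting a vertex of `A`. -/
theorem exists_mem_convexHull_erase {A B : Finset E} {p y : E} (hAB : Disjoint A B)
    (hA : PosComb A p) (hB : PosComb B p) (hy : y ∈ convexHull ℝ (A ∪ B : Set E)) :
    ∃ a ∈ A, y ∈ convexHull ℝ (((A ∪ B).erase a : Finset E) : Set E) := by
  obtain ⟨α, hα0, hα1, hα2⟩ := hA
  obtain ⟨β, hβ0, hβ1, hβ2⟩ := hB
  rw [← Finset.coe_union] at hy
  obtain ⟨c, hc0, hc1, hc2⟩ := Finset.mem_convexHull'.1 hy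
  have hAne : A.Nonempty := PosComb.nonempty ⟨α, hα0, hα1, hα2⟩
  obtain ⟨a, ha, hmin⟩ := Finset.exists_min_image A (fun v => c v / α v) hAne
  set t := c a / α a with ht
  have ht0 : 0 ≤ t := div_nonneg (hc0 a (Finset.mem_union_left _ ha)) (hα0 a ha).le
  let c' : E → ℝ := fun v => c v + if v ∈ A then -(t * α v) else t * β v
  have hB' : ∀ v ∈ B, v ∉ A := fun v hv h => Finset.disjoint_left.1 hAB h hv
  have hcA : ∀ v ∈ A, c' v = c v - t * α v := fun v hv => by simp [c', hv, sub_eq_add_neg]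
  have hcB : ∀ v ∈ B, c' v = c v + t * β v := fun v hv => by simp [c', hB' v hv]
  have hca : c' a = 0 := by
    rw [hcA a ha, ht, div_mul_cancel₀ _ (hα0 a ha).ne', sub_self]
  refine ⟨a, ha, Finset.mem_convexHull'.2 ⟨c', fun v hv => ?_, ?_, ?_⟩⟩
  · rcases Finset.mem_union.1 (Finset.mem_of_mem_erase hv) with h | h
    · rw [hcA v h]
      have := (le_div_iff₀ (hα0 v h)).1 (hmin v h)
      linarith
    · rw [hcB v h]
      have := hc0 v (Finset.mem_union_right _ h)
      have := mul_nonneg ht0 (hβ0 v h).le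
      linarith
  · have : ∑ v ∈ A ∪ B, c' v = 1 := by
      rw [Finset.sum_union hAB, Finset.sum_congr rfl hcA, Finset.sum_congr rfl hcB,
        Finset.sum_sub_distrib, Finset.sum_add_distrib, ← Finset.mul_sum, ← Finset.mul_sum, hα1, hβ1,
        ← hc1, Finset.sum_union hAB]
      ring
    rw [← Finset.add_sum_erase _ _ (Finset.mem_union_left B ha), hca, zero_add] at this
    exact this
  · have : ∑ v ∈ A ∪ B, c' v • v = y := by
      rw [Finset.sum_union hAB, Finset.sum_congr rfl fun v hv => by rw [hcA v hv, sub_smul, mul_smul],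
        Finset.sum_congr (s₁ := B) rfl fun v hv => by rw [hcB v hv, add_smul, mul_smul],
        Finset.sum_sub_distrib, Finset.sum_add_distrib, ← Finset.smul_sum, ← Finset.smul_sum, hα2,
        hβ2, ← hc2, Finset.sum_union hAB]
      abel
    rw [← Finset.add_sum_erase _ _ (Finset.mem_union_left B ha), hca, zero_smul, zero_add] at this
    exact this

/-- Two lower envelope complexes which differ only inside a simplex-like circuit `A ∪ B` are
related by a bistellar move. -/
theorem exists_flip [FiniteDimensional ℝ E] {n : ℕ} {V A B : Finset E} {w₁ w₂ : E → ℝ} {p : E}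
    {T : Geometry.SimplicialComplex ℝ E} (hT : Certified V w₁ T) (hAB : Disjoint A B)
    (hcard : A.card + B.card = n + 2) (hAp : PosComb A p) (hBp : PosComb B p)
    (hmem : p ∈ interior (convexHull ℝ (A ∪ B : Set E))) (hV : A ∪ B ⊆ V)
    (h₁ : ∀ b ∈ B, (A ∪ B).erase b ∈ T.faces) (h₂ : ∀ a ∈ A, Cert V w₂ ((A ∪ B).erase a))
    (hind : ∀ a ∈ A, AffineIndependent ℝ ((↑) : (A ∪ B).erase a → E))
    (hother : ∀ s ∈ T.faces, ¬ A ⊆ s → s ⊆ A ∪ B ∨ Cert V w₂ s) :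
    ∃ T' : Geometry.SimplicialComplex ℝ E, Certified V w₂ T' ∧ T'.space = T.space ∧
      BistellarMove n T T' ∧ ∀ s ∈ T.faces, Cert V w₂ s → s ∈ T'.faces := by
  have hdl := Finset.disjoint_left.1 hAB
  have hsubZ : ∀ s ⊆ A ∪ B, ¬ B ⊆ s → s.Nonempty → s ∈ T.faces := fun s hs hBs hne => by
    obtain ⟨b, hb, hbs⟩ := Finset.not_subset.1 hBs
    exact T.down_closed (h₁ b hb) (Finset.subset_erase.2 ⟨hs, hbs⟩) hne
  have hcertZ : ∀ s ⊆ A ∪ B, ¬ A ⊆ s → Cert V w₂ s := fun s hs hAs => by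
    obtain ⟨a, ha, has⟩ := Finset.not_subset.1 hAs
    exact (h₂ a ha).mono (hind a ha) (Finset.subset_erase.2 ⟨hs, has⟩)
  have hAT : A ∈ T.faces := by
    refine hsubZ A Finset.subset_union_left (fun h => ?_) hAp.nonempty
    obtain ⟨b, hb⟩ := hBp.nonempty
    exact hdl (h hb) hb
  have hBT : B ∉ T.faces := fun h => by
    have := subset_of_mem_faces h hAT hBp hAp.mem_convexHull
    obtain ⟨b, hb⟩ := hBp.nonempty
    exact hdl (this hb) hb
  have hnAB : ¬ A ⊆ B := fun h => by
    obtain ⟨a, ha⟩ := hAp.nonempty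
    exact hdl ha (h ha)
  let F : Set (Finset E) := (T.faces \ {s | A ⊆ s}) ∪ {s | ∃ A' : Finset E, A' ⊂ A ∧ s = A' ∪ B}
  have hFmem : ∀ s, s ∈ F ↔ (s ∈ T.faces ∧ ¬ A ⊆ s) ∨ ∃ A' ⊂ A, s = A' ∪ B := fun s => by
    simp [F]
  have hnA : ∀ {A'}, A' ⊂ A → ¬ A ⊆ A' ∪ B := fun {A'} hA' h => by
    refine hA'.2 fun a ha => ?_
    rcases Finset.mem_union.1 (h ha) with h | h
    · exact h
    · exact (hdl ha h).elim
  have hFZ : ∀ {A'}, A' ⊂ A → A' ∪ B ⊆ A ∪ B := fun {A'} hA' =>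
    Finset.union_subset_union_left hA'.subset
  have hmemF : ∀ s ⊆ A ∪ B, ¬ A ⊆ s → s.Nonempty → s ∈ F := by
    intro s hs hAs hne
    rw [hFmem]
    by_cases hBs : B ⊆ s
    · refine Or.inr ⟨s \ B, Finset.ssubset_iff_subset_ne.2 ⟨fun v hv => ?_, ?_⟩,
        (Finset.sdiff_union_of_subset hBs).symm⟩
      · obtain ⟨h1, h2⟩ := Finset.mem_sdiff.1 hv
        exact (Finset.mem_union.1 (hs h1)).resolve_right h2
      · exact fun h => hAs (h ▸ Finset.sdiff_subset)
    · exact Or.inl ⟨hsubZ s hs hBs hne, hAs⟩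
  let T' : Geometry.SimplicialComplex ℝ E := ofCert V w₂ F
    (fun s hs => by
      rcases (hFmem s).1 hs with h | ⟨A', -, rfl⟩
      · exact T.nonempty_of_mem_faces h.1
      · exact hBp.nonempty.mono Finset.subset_union_right)
    (fun s hs => by
      rcases (hFmem s).1 hs with h | ⟨A', hA', rfl⟩
      · exact hT.subset s h.1
      · exact (hFZ hA').trans hV)
    (fun s hs t hts hne => by
      rcases (hFmem s).1 hs with h | ⟨A', hA', rfl⟩
      · exact (hFmem t).2 (Or.inl ⟨T.down_closed h.1 hts hne, fun h' => h.2 (h'.trans hts)⟩)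
      · exact hmemF t (hts.trans (hFZ hA')) (fun h => hnA hA' (h.trans hts)) hne)
    (fun s hs => by
      rcases (hFmem s).1 hs with h | ⟨A', hA', rfl⟩
      · rcases hother s h.1 h.2 with h' | h'
        · exact hcertZ s h' h.2
        · exact h'
      · exact hcertZ _ (hFZ hA') (hnA hA'))
  have hlink : ∀ C : Finset E, C.Nonempty → Disjoint A C → A ∪ C ∈ T.faces → C ⊂ B := by
    intro C hC hAC hACT
    obtain ⟨q, hq⟩ := exists_posComb (T.nonempty_of_mem_faces hACT)
    have hlim : Filter.Tendsto (fun θ : ℝ => (1 - (1 - θ)) • q + (1 - θ) • p)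
        (nhdsWithin 0 (Ioi 0)) (nhds p) := by
      have : Filter.Tendsto (fun θ : ℝ => (1 - (1 - θ)) • q + (1 - θ) • p) (nhds 0)
          (nhds ((1 - (1 - (0 : ℝ))) • q + (1 - (0 : ℝ)) • p)) :=
        Continuous.tendsto (by fun_prop) _
      simp only [sub_zero, sub_self, zero_smul, one_smul, zero_add] at this
      exact this.mono_left nhdsWithin_le_nhds
    have hlt : ∀ᶠ θ : ℝ in nhdsWithin 0 (Ioi 0), θ < 1 :=
      nhdsWithin_le_nhds (gt_mem_nhds one_pos)
    obtain ⟨θ, ⟨hθ, hθ1⟩, hθ0⟩ := (((hlim.eventually (isOpen_interior.mem_nhds hmem)).and hlt).and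
      self_mem_nhdsWithin).exists
    have hθ0 : 0 < θ := hθ0
    rw [Set.union_comm] at hθ
    obtain ⟨b, hb, hbz⟩ := exists_mem_convexHull_erase hAB.symm hBp hAp (interior_subset hθ)
    rw [Finset.union_comm B A] at hbz
    have hpos := hq.lineMap hAp.mem_convexHull (Finset.subset_union_left (s₂ := C))
      (θ := 1 - θ) (by linarith) (by linarith)
    have hsub := subset_of_mem_faces hACT (h₁ b hb) hpos hbz
    have hCB : C ⊆ B.erase b := fun v hv => by
      have h1 := hsub (Finset.mem_union_right A hv)
      rw [Finset.mem_erase, Finset.mem_union] at h1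
      refine Finset.mem_erase.2 ⟨h1.1, h1.2.resolve_left fun h => Finset.disjoint_left.1 hAC h hv⟩
    exact lt_of_le_of_lt hCB (Finset.erase_ssubset hb)
  have hspace : T'.space = T.space := by
    apply Subset.antisymm
    · intro y hy
      obtain ⟨s, hs, hys⟩ := Geometry.SimplicialComplex.mem_space_iff.1 hy
      rcases (hFmem s).1 hs with h | ⟨A', hA', rfl⟩
      · exact T.convexHull_subset_space h.1 hys
      · have hy' : y ∈ convexHull ℝ (B ∪ A : Set E) := by
          refine convexHull_mono ?_ hys
          rw [Set.union_comm]
          rw [← Finset.coe_union]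
          exact Finset.coe_subset.2 (hFZ hA')
        obtain ⟨b, hb, hbz⟩ := exists_mem_convexHull_erase hAB.symm hBp hAp hy'
        rw [Finset.union_comm B A] at hbz
        exact T.convexHull_subset_space (h₁ b hb) hbz
    · intro y hy
      obtain ⟨s, hs, hys⟩ := Geometry.SimplicialComplex.mem_space_iff.1 hy
      obtain ⟨r, hrs, hr⟩ := exists_posComb_of_mem_convexHull hys
      have hrT := T.down_closed hs hrs hr.nonempty
      by_cases hAr : A ⊆ r
      · have hrZ : r ⊆ A ∪ B := by
          rcases (r \ A).eq_empty_or_nonempty with h | h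
          · exact (Finset.sdiff_eq_empty_iff_subset.1 h).trans Finset.subset_union_left
          · have := hlink (r \ A) h Finset.disjoint_sdiff
              (by rwa [Finset.union_sdiff_of_subset hAr])
            rw [← Finset.union_sdiff_of_subset hAr]
            exact Finset.union_subset_union_right this.subset
        have hy' : y ∈ convexHull ℝ (A ∪ B : Set E) :=
          convexHull_mono (by rw [← Finset.coe_union]; exact Finset.coe_subset.2 hrZ) hr.mem_convexHull
        obtain ⟨a, ha, haz⟩ := exists_mem_convexHull_erase hAB hAp hBp hy'
        refine T'.convexHull_subset_space (s := (A ∪ B).erase a) ?_ haz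
        refine hmemF _ (Finset.erase_subset _ _) (fun h => ?_) ?_
        · simpa using h ha
        · obtain ⟨b, hb⟩ := hBp.nonempty
          exact ⟨b, Finset.mem_erase.2 ⟨by rintro rfl; exact hdl ha hb, Finset.mem_union_right _ hb⟩⟩
      · exact T'.convexHull_subset_space (s := r) ((hFmem r).2 (Or.inl ⟨hrT, hAr⟩)) hr.mem_convexHull
  refine ⟨T', ⟨fun s hs => ?_, fun s hs => ?_⟩, hspace,
    ⟨A, B, hAT, hBT, hBp.nonempty, hcard, ?_, rfl, hspace⟩, fun s hs hsc => ?_⟩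
  · rcases (hFmem s).1 hs with h | ⟨A', hA', rfl⟩
    · exact hT.subset s h.1
    · exact (hFZ hA').trans hV
  · rcases (hFmem s).1 hs with h | ⟨A', hA', rfl⟩
    · rcases hother s h.1 h.2 with h' | h'
      · exact hcertZ s h' h.2
      · exact h'
    · exact hcertZ _ (hFZ hA') (hnA hA')
  · ext C
    simp only [Set.mem_ofPred_eq]
    refine and_congr_right fun hC => ⟨fun h => hlink C hC h.1 h.2, fun h => ⟨hAB.mono_right h.subset,
      hsubZ _ (Finset.union_subset_union_right h.subset) (fun hB => ?_) ?_⟩⟩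
    · refine h.2 fun b hb => ?_
      exact (Finset.mem_union.1 (hB hb)).resolve_left fun h => hdl h hb
    · exact hAp.nonempty.mono Finset.subset_union_left
  · refine (hFmem s).2 (Or.inl ⟨hs, fun hAs => ?_⟩)
    obtain ⟨l, hl1, hl2⟩ := hcertZ B Finset.subset_union_right hnAB
    have hBs := Cert.subset_of_posComb hl1 (fun v hv => by
      by_cases h : v ∈ B
      · exact (hl1 v h).le
      · exact (hl2 v hv h).le) (Finset.subset_union_right.trans hV) hsc (hT.subset s hs) hBp
      (convexHull_mono (by exact_mod_cast hAs) hAp.mem_convexHull)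
    exact hBT (T.down_closed hs hBs hBp.nonempty)

/-! ### Full-dimensional simplices and barycentric coordinates -/

/-- An affinely independent set of the maximal number of points. -/
def FullSimplex (s : Finset E) : Prop :=
  AffineIndependent ℝ ((↑) : s → E) ∧ s.card = Module.finrank ℝ E + 1

/-- The barycentric coordinates with respect to a full-dimensional simplex. -/
noncomputable def coord (s : Finset E) : E → E →ᵃ[ℝ] ℝ :=
  if h : ∃ c : E → E →ᵃ[ℝ] ℝ, (∀ u ∈ s, ∀ v ∈ s, c u v = if u = v then 1 else 0) ∧
    (∀ y, ∑ u ∈ s, c u y = 1) ∧ ∀ y, ∑ u ∈ s, c u y • u = y then h.choose else 0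

/-- The affine functional with prescribed values on a full-dimensional simplex. -/
noncomputable def interp (s : Finset E) (w : E → ℝ) : E →ᵃ[ℝ] ℝ := ∑ u ∈ s, w u • coord s u

theorem interp_apply (s : Finset E) (w : E → ℝ) (y : E) :
    interp s w y = ∑ u ∈ s, coord s u y * w u := by
  rw [interp, sum_smul_affine_apply]
  exact Finset.sum_congr rfl fun u _ => mul_comm _ _

section FullSimplex

variable [FiniteDimensional ℝ E] {s : Finset E}

theorem FullSimplex.coord_spec (hs : FullSimplex s) :
    (∀ u ∈ s, ∀ v ∈ s, coord s u v = if u = v then 1 else 0) ∧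
      (∀ y, ∑ u ∈ s, coord s u y = 1) ∧ ∀ y, ∑ u ∈ s, coord s u y • u = y := by
  have h : ∃ c : E → E →ᵃ[ℝ] ℝ, (∀ u ∈ s, ∀ v ∈ s, c u v = if u = v then 1 else 0) ∧
      (∀ y, ∑ u ∈ s, c u y = 1) ∧ ∀ y, ∑ u ∈ s, c u y • u = y := by
    obtain ⟨t, c, hst, ht, hc⟩ := exists_coords hs.1
    obtain rfl := Finset.eq_of_subset_of_card_le hst (by rw [ht, hs.2])
    exact ⟨c, hc⟩
  rw [coord, dif_pos h]
  exact h.choose_spec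

theorem FullSimplex.coord_self (hs : FullSimplex s) {u : E} (hu : u ∈ s) : coord s u u = 1 := by
  rw [hs.coord_spec.1 u hu u hu, if_pos rfl]

theorem FullSimplex.coord_of_ne (hs : FullSimplex s) {u v : E} (hu : u ∈ s) (hv : v ∈ s)
    (h : u ≠ v) : coord s u v = 0 := by
  rw [hs.coord_spec.1 u hu v hv, if_neg h]

theorem FullSimplex.apply_eq (hs : FullSimplex s) (l : E →ᵃ[ℝ] ℝ) (y : E) :
    l y = ∑ u ∈ s, coord s u y * l u := by
  rw [← map_sum_smul l (hs.coord_spec.2.1 y), hs.coord_spec.2.2]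

theorem FullSimplex.eq_interp (hs : FullSimplex s) {l : E →ᵃ[ℝ] ℝ} {w : E → ℝ}
    (h : ∀ v ∈ s, l v = w v) (y : E) : l y = interp s w y := by
  rw [hs.apply_eq l, interp_apply]
  exact Finset.sum_congr rfl fun u hu => by rw [h u hu]

theorem FullSimplex.interp_of_mem (hs : FullSimplex s) (w : E → ℝ) {v : E} (hv : v ∈ s) :
    interp s w v = w v := by
  obtain ⟨l, hl⟩ := exists_affine_eq hs.1 w
  rw [← hs.eq_interp hl, hl v hv]

theorem FullSimplex.mem_interior (hs : FullSimplex s) {Z : Finset E} (hsZ : s ⊆ Z) {p : E}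
    (hp : PosComb Z p) : p ∈ interior (convexHull ℝ (Z : Set E)) := by
  obtain ⟨a, h0, h1, h2⟩ := hp
  have hcont : ∀ u, Continuous (coord s u) := fun u => (coord s u).continuous_of_finiteDimensional
  have hopen : IsOpen {y | ∀ u ∈ s, 0 < a u + (coord s u y - coord s u p)} := by
    have : {y | ∀ u ∈ s, 0 < a u + (coord s u y - coord s u p)} =
        ⋂ u ∈ s, {y | 0 < a u + (coord s u y - coord s u p)} := by ext; simp
    rw [this]
    exact isOpen_biInter_finset fun u _ => isOpen_lt continuous_const (by fun_prop)
  refine _root_.mem_interior.2 ⟨_, fun y hy => ?_, hopen, fun u hu => by simpa using h0 u (hsZ hu)⟩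
  refine Finset.mem_convexHull'.2
    ⟨fun u => a u + if u ∈ s then coord s u y - coord s u p else 0, fun u hu => ?_, ?_, ?_⟩
  · by_cases hus : u ∈ s
    · simpa [hus] using (hy u hus).le
    · simpa [hus] using (h0 u hu).le
  · rw [Finset.sum_add_distrib, h1, ← Finset.sum_filter, Finset.filter_mem_eq_inter,
      Finset.inter_eq_right.2 hsZ, Finset.sum_sub_distrib, hs.coord_spec.2.1, hs.coord_spec.2.1]
    simp
  · simp only [add_smul, ite_smul, zero_smul]
    rw [Finset.sum_add_distrib, h2, ← Finset.sum_filter, Finset.filter_mem_eq_inter,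
      Finset.inter_eq_right.2 hsZ]
    simp only [sub_smul]
    rw [Finset.sum_sub_distrib, hs.coord_spec.2.2, hs.coord_spec.2.2]
    simp

end FullSimplex

theorem affineIndependent_of_dual {s : Finset E}
    (h : ∀ u ∈ s, ∃ l : E →ᵃ[ℝ] ℝ, 0 < l u ∧ ∀ v ∈ s, v ≠ u → l v = 0) :
    AffineIndependent ℝ ((↑) : s → E) := by
  choose! l hl0 hl using h
  refine affineIndependent_of_cert (w := 0) fun t hts _ =>
    ⟨∑ u ∈ s \ t, (-1 : ℝ) • l u, fun v hv => ?_, fun v hv hvt => ?_⟩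
  · rw [sum_smul_affine_apply]
    refine Finset.sum_eq_zero fun u hu => ?_
    obtain ⟨hu, hut⟩ := Finset.mem_sdiff.1 hu
    rw [hl u hu v (hts hv) (by rintro rfl; exact hut hv), mul_zero]
  · rw [sum_smul_affine_apply, Finset.sum_eq_single v]
    · simpa using hl0 v hv
    · intro u hu huv
      rw [hl u (Finset.mem_sdiff.1 hu).1 v hv huv.symm, mul_zero]
    · intro h
      exact absurd (Finset.mem_sdiff.2 ⟨hv, hvt⟩) h

theorem eventually_residual_ne_zero [FiniteDimensional ℝ E] {g : E →ᵃ[ℝ] ℝ}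
    (hg : ∃ y, g y ≠ 0) : ∀ᶠ x in residual E, g x ≠ 0 := by
  have hcont : Continuous g := g.continuous_of_finiteDimensional
  refine residual_of_dense_open (isOpen_ne_fun hcont continuous_const) fun x => ?_
  by_cases hgx : g x = 0
  · obtain ⟨y, hy⟩ := hg
    have hc : Continuous fun θ : ℝ => (1 - θ) • x + θ • y := by fun_prop
    have h1 : Filter.Tendsto (fun θ : ℝ => (1 - θ) • x + θ • y) (nhdsWithin 0 (Ioi 0))
        (nhds x) := by
      simpa using (hc.tendsto 0).mono_left (nhdsWithin_le_nhds (s := Ioi 0))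
    refine mem_closure_of_tendsto h1 (Filter.mem_of_superset self_mem_nhdsWithin fun θ hθ => ?_)
    have hθ0 : 0 < θ := hθ
    change g _ ≠ 0
    rw [affine_lineMap, hgx]
    simpa using ⟨hθ0.ne', hy⟩
  · exact subset_closure hgx

theorem exists_mem_of_eventually_residual [FiniteDimensional ℝ E] {p : E → Prop}
    (hp : ∀ᶠ x in residual E, p x) {U : Set E} (hU : IsOpen U) (hne : U.Nonempty) :
    ∃ x ∈ U, p x := by
  have := FiniteDimensional.complete ℝ E
  exact (dense_of_mem_residual hp).inter_open_nonempty U hU hne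

/-- A nonzero functional vanishing on a small affinely independent set. -/
theorem exists_vanishing [FiniteDimensional ℝ E] {t : Finset E}
    (ht : AffineIndependent ℝ ((↑) : t → E)) (hcard : t.card ≠ Module.finrank ℝ E + 1) :
    ∃ g : E →ᵃ[ℝ] ℝ, (∃ y, g y ≠ 0) ∧ ∀ y ∈ convexHull ℝ (t : Set E), g y = 0 := by
  obtain ⟨r, c, htr, hr, hc, -, -⟩ := exists_coords ht
  obtain ⟨u, hu, hut⟩ : ∃ u ∈ r, u ∉ t := by
    by_contra! h
    exact hcard (by rw [← hr, htr.antisymm h])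
  refine ⟨c u, ⟨u, by simp [hc u hu u hu]⟩, fun y hy => ?_⟩
  refine eq_of_mem_convexHull (l' := 0) hy fun v hv => ?_
  rw [hc u hu v (htr hv), if_neg (by rintro rfl; exact hut hv)]
  rfl

theorem exists_fullSimplex_of_mem_interior [FiniteDimensional ℝ E]
    {X : Geometry.SimplicialComplex ℝ E} (hX : X.faces.Finite) {y : E}
    (hy : y ∈ interior X.space) :
    ∃ t ∈ X.faces, FullSimplex t ∧ y ∈ convexHull ℝ (t : Set E) := by
  have hcl : IsClosed (⋃ t ∈ {t ∈ X.faces | y ∉ convexHull ℝ (t : Set E)},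
      convexHull ℝ (t : Set E)) :=
    (hX.subset fun t ht => ht.1).isClosed_biUnion fun t _ =>
      (t.finite_toSet.isCompact_convexHull (𝕜 := ℝ)).isClosed
  have hres : ∀ᶠ x in residual E, ∀ t ∈ X.faces, ¬ FullSimplex t →
      x ∉ convexHull ℝ (t : Set E) := by
    refine (Filter.eventually_all_finite hX).2 fun t ht => ?_
    by_cases hft : FullSimplex t
    · simp [hft]
    · obtain ⟨g, hg0, hg⟩ := exists_vanishing (X.indep ht) fun hc => hft ⟨X.indep ht, hc⟩
      filter_upwards [eventually_residual_ne_zero hg0] with x hx _ hxt using hx (hg x hxt)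
  obtain ⟨x, ⟨hx, hxU⟩, hxg⟩ := exists_mem_of_eventually_residual hres
    (isOpen_interior.inter hcl.isOpen_compl) ⟨y, hy, by simp⟩
  obtain ⟨t, ht, hxt⟩ := Geometry.SimplicialComplex.mem_space_iff.1 (interior_subset hx)
  refine ⟨t, ht, by_contra fun hft => hxg t ht hft hxt, by_contra fun hyt => ?_⟩
  exact hxU (mem_biUnion (x := t) ⟨ht, hyt⟩ hxt)

/-- The points of the relative interior of a face which is not on the frontier. -/
theorem mem_interior_of_frontier [FiniteDimensional ℝ E] {X : Geometry.SimplicialComplex ℝ E}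
    {M : Set (Finset E)}
    (hMX : M ⊆ X.faces) (hM : ∀ m ∈ M, ∀ t ⊆ m, t.Nonempty → t ∈ M)
    (hfr : frontier X.space ⊆ ⋃ m ∈ M, convexHull ℝ (m : Set E)) {s : Finset E}
    (hs : s ∈ X.faces) (hsM : s ∉ M) {y : E} (hy : PosComb s y) : y ∈ interior X.space := by
  by_contra hyi
  obtain ⟨m, hm, hym⟩ := mem_iUnion₂.1 (hfr ⟨subset_closure
    (X.convexHull_subset_space hs hy.mem_convexHull), hyi⟩)
  exact hsM (hM m hm s (subset_of_mem_faces hs (hMX hm) hy hym) hy.nonempty)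

theorem exists_fullSimplex_superset [FiniteDimensional ℝ E] {X : Geometry.SimplicialComplex ℝ E}
    (hX : X.faces.Finite) {M : Set (Finset E)}
    (hMX : M ⊆ X.faces) (hM : ∀ m ∈ M, ∀ t ⊆ m, t.Nonempty → t ∈ M)
    (hfr : frontier X.space ⊆ ⋃ m ∈ M, convexHull ℝ (m : Set E)) {s : Finset E}
    (hs : s ∈ X.faces) (hsM : s ∉ M) : ∃ t ∈ X.faces, FullSimplex t ∧ s ⊆ t := by
  obtain ⟨y, hy⟩ := exists_posComb (X.nonempty_of_mem_faces hs)
  obtain ⟨t, ht, htf, hyt⟩ := exists_fullSimplex_of_mem_interior hX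
    (mem_interior_of_frontier hMX hM hfr hs hsM hy)
  exact ⟨t, ht, htf, subset_of_mem_faces hs ht hy hyt⟩

/-- The circuit formed by a simplex and a point in general position. -/
theorem exists_circuit {s : Finset E} {x : E} (hx : x ∉ s) {a : E → ℝ} (ha : ∀ u ∈ s, a u ≠ 0)
    (h1 : ∑ u ∈ s, a u = 1) (h2 : ∑ u ∈ s, a u • u = x) :
    ∃ p, PosComb (s.filter fun u => 0 < a u) p ∧
      PosComb (insert x (s.filter fun u => a u < 0)) p := by
  have hneg : s.filter (fun u => ¬ 0 < a u) = s.filter fun u => a u < 0 :=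
    Finset.filter_congr fun u hu => by rw [not_lt, (ha u hu).le_iff_lt]
  have e1 := Finset.sum_filter_add_sum_filter_not s (fun u => 0 < a u) a
  have e2 := Finset.sum_filter_add_sum_filter_not s (fun u => 0 < a u) fun u => a u • u
  rw [hneg, h1] at e1
  rw [hneg, h2] at e2
  set A := s.filter fun u => 0 < a u
  set B := s.filter fun u => a u < 0
  have hB : ∑ u ∈ B, a u ≤ 0 := Finset.sum_nonpos fun u hu => (Finset.mem_filter.1 hu).2.le
  set c := ∑ u ∈ A, a u with hc
  have hc0 : 0 < c := by linarith
  have hxB : x ∉ B := fun h => hx (Finset.mem_filter.1 h).1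
  refine ⟨∑ u ∈ A, (c⁻¹ * a u) • u, ⟨fun u => c⁻¹ * a u, fun u hu => ?_, ?_, rfl⟩,
    ⟨fun u => if u = x then c⁻¹ else c⁻¹ * -a u, fun u hu => ?_, ?_, ?_⟩⟩
  · have := (Finset.mem_filter.1 hu).2
    positivity
  · rw [← Finset.mul_sum, ← hc, inv_mul_cancel₀ hc0.ne']
  · beta_reduce
    split_ifs with h
    · positivity
    · have := (Finset.mem_filter.1 ((Finset.mem_insert.1 hu).resolve_left h)).2
      have : 0 < -a u := by linarith
      positivity
  · rw [Finset.sum_insert hxB, if_pos rfl, Finset.sum_congr rfl fun u hu =>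
      if_neg (by rintro rfl; exact hxB hu), ← Finset.mul_sum, Finset.sum_neg_distrib]
    field_simp
    linarith
  · simp only [ite_smul]
    rw [Finset.sum_insert hxB, if_pos rfl, Finset.sum_congr rfl fun u hu =>
      if_neg (by rintro rfl; exact hxB hu)]
    nth_rw 1 [← e2]
    simp only [mul_smul, ← Finset.smul_sum, neg_smul, Finset.sum_neg_distrib]
    rw [← smul_add]
    simp

theorem PosComb.union {A B : Finset E} (hAB : Disjoint A B) {p : E} (hA : PosComb A p)
    (hB : PosComb B p) : PosComb (A ∪ B) p := by
  obtain ⟨a, ha0, ha1, ha2⟩ := hA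
  obtain ⟨b, hb0, hb1, hb2⟩ := hB
  have hd := Finset.disjoint_left.1 hAB
  refine ⟨fun u => if u ∈ A then a u / 2 else b u / 2, fun u hu => ?_, ?_, ?_⟩
  · by_cases h : u ∈ A
    · simpa [h] using ha0 u h
    · simpa [h] using hb0 u ((Finset.mem_union.1 hu).resolve_left h)
  · rw [Finset.sum_union hAB, Finset.sum_congr rfl fun u hu => if_pos hu,
      Finset.sum_congr (s₁ := B) rfl fun u hu => if_neg fun h => hd h hu, ← Finset.sum_div,
      ← Finset.sum_div, ha1, hb1]
    norm_num
  · simp only [ite_smul]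
    rw [Finset.sum_union hAB, Finset.sum_congr rfl fun u hu => if_pos hu,
      Finset.sum_congr (s₁ := B) rfl fun u hu => if_neg fun h => hd h hu]
    simp only [div_eq_inv_mul, mul_smul]
    rw [← Finset.smul_sum, ← Finset.smul_sum, ha2, hb2, ← add_smul]
    norm_num

theorem PosComb.insert {F : Finset E} {q x : E} (hq : PosComb F q) (hx : x ∉ F) {θ : ℝ}
    (h0 : 0 < θ) (h1 : θ < 1) : PosComb (insert x F) ((1 - θ) • q + θ • x) := by
  obtain ⟨a, ha0, ha1, ha2⟩ := hq
  refine ⟨fun u => if u = x then θ else (1 - θ) * a u, fun u hu => ?_, ?_, ?_⟩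
  · beta_reduce
    split_ifs with hu'
    · exact h0
    · exact mul_pos (by linarith) (ha0 u ((Finset.mem_insert.1 hu).resolve_left hu'))
  · rw [Finset.sum_insert hx, if_pos rfl, Finset.sum_congr rfl fun u hu =>
      if_neg (by rintro rfl; exact hx hu), ← Finset.mul_sum, ha1]
    ring
  · simp only [ite_smul]
    rw [Finset.sum_insert hx, if_pos rfl, Finset.sum_congr rfl fun u hu =>
      if_neg (by rintro rfl; exact hx hu)]
    simp only [mul_smul]
    rw [← Finset.smul_sum, ha2, add_comm]

/-! ### Inserting a new point -/

/-- The data for inserting the point `x` with height `c` into the lower envelope complex `T`,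
keeping `M` fixed. -/
structure Insertable (V : Finset E) (w : E → ℝ) (T : Geometry.SimplicialComplex ℝ E)
    (M : Set (Finset E)) (x : E) (c : ℝ) : Prop where
  certified : Certified V w T
  notMem : x ∉ V
  subset : M ⊆ T.faces
  down : ∀ m ∈ M, ∀ t ⊆ m, t.Nonempty → t ∈ M
  frontier_subset : frontier T.space ⊆ ⋃ m ∈ M, convexHull ℝ (m : Set E)
  below : ∀ m ∈ M, ∃ l : E →ᵃ[ℝ] ℝ, (∀ v ∈ m, l v = w v) ∧ (∀ v ∈ V, v ∉ m → l v < w v) ∧ l x < c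
  coord_ne_zero : ∀ s ∈ T.faces, FullSimplex s → ∀ u ∈ s, coord s u x ≠ 0
  interp_injOn : ∀ s ∈ T.faces, FullSimplex s → ∀ s' ∈ T.faces, FullSimplex s' →
    interp s w x = interp s' w x → s = s'
  interp_ne : ∀ s ∈ T.faces, FullSimplex s → interp s w x ≠ c

/-- `X` is the lower envelope complex obtained from `T` by adding `x` at height `t`. -/
structure InsertState (V : Finset E) (w : E → ℝ) (T : Geometry.SimplicialComplex ℝ E)
    (M : Set (Finset E)) (x : E) (t : ℝ) (X : Geometry.SimplicialComplex ℝ E) : Prop where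
  certified : Certified (insert x V) (Function.update w x t) X
  space_eq : X.space = T.space
  subset : M ⊆ X.faces

section Insert

variable {V : Finset E} {w : E → ℝ} {T X : Geometry.SimplicialComplex ℝ E}
  {M : Set (Finset E)} {x : E} {c t t' : ℝ}

theorem cert_insert {s : Finset E} {l : E →ᵃ[ℝ] ℝ} (hx : x ∉ V) (hl : ∀ v ∈ s, v ≠ x → l v = w v)
    (hxs : x ∈ s → l x = t) (hxs' : x ∉ s → l x < t) (hlV : ∀ v ∈ V, v ∉ s → l v < w v) :
    Cert (insert x V) (Function.update w x t) s := by
  refine ⟨l, fun v hv => ?_, fun v hv hvs => ?_⟩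
  · by_cases h : v = x
    · subst h; simpa using hxs hv
    · rw [Function.update_of_ne h, hl v hv h]
  · by_cases h : v = x
    · subst h; simpa using hxs' hvs
    · rw [Function.update_of_ne h]
      exact hlV v ((Finset.mem_insert.1 hv).resolve_left h) hvs

theorem Insertable.cert_of_mem (h : Insertable V w T M x c) (ht : c ≤ t) {m : Finset E}
    (hm : m ∈ M) : Cert (insert x V) (Function.update w x t) m := by
  obtain ⟨l, h1, h2, h3⟩ := h.below m hm
  have hxm : x ∉ m := fun hxm => h.notMem (h.certified.subset m (h.subset hm) hxm)
  exact cert_insert h.notMem (fun v hv _ => h1 v hv) (fun h => absurd h hxm)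
    (fun _ => h3.trans_le ht) h2

variable [FiniteDimensional ℝ E]

/-- Each full-dimensional simplex persists until the height passes a critical value. -/
theorem Insertable.persist (h : Insertable V w T M x c) (hE : 0 < Module.finrank ℝ E)
    (hX : InsertState V w T M x t X) (hct : c ≤ t') (htt : t' ≤ t) {s : Finset E}
    (hs : s ∈ X.faces) (hfull : FullSimplex s)
    (hnc : ¬ Cert (insert x V) (Function.update w x t') s) :
    ∃ r ∈ T.faces, FullSimplex r ∧ t' ≤ interp r w x ∧ interp r w x ≤ t ∧
      (s = r ∨ ∃ v ∈ r, s = insert x (r.erase v)) := by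
  have hsV := hX.certified.subset s hs
  obtain ⟨l, hl1, hl2⟩ := hX.certified.cert s hs
  have hne : ∀ v ∈ V, v ≠ x := fun v hv => by rintro rfl; exact h.notMem hv
  by_cases hxs : x ∈ s
  swap
  · have hsV' : s ⊆ V := fun v hv =>
      (Finset.mem_insert.1 (hsV hv)).resolve_left (by rintro rfl; exact hxs hv)
    have h1 : ∀ v ∈ s, l v = w v := fun v hv => by
      rw [hl1 v hv, Function.update_of_ne (hne v (hsV' hv))]
    have h2 : ∀ v ∈ V, v ∉ s → l v < w v := fun v hv hvs => by
      have := hl2 v (Finset.mem_insert_of_mem hv) hvs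
      rwa [Function.update_of_ne (hne v hv)] at this
    have h3 : l x < t := by simpa using hl2 x (Finset.mem_insert_self _ _) hxs
    obtain ⟨y, hy⟩ := exists_posComb (X.nonempty_of_mem_faces hs)
    refine ⟨s, h.certified.mem_faces_of_cert ⟨l, h1, h2⟩ hsV' hy ?_, hfull, ?_, ?_, Or.inl rfl⟩
    · rw [← hX.space_eq]
      exact X.convexHull_subset_space hs hy.mem_convexHull
    · rw [← hfull.eq_interp h1]
      by_contra! hlt
      exact hnc (cert_insert h.notMem (fun v hv _ => h1 v hv) (fun h => absurd h hxs)
        (fun _ => hlt) h2)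
    · rw [← hfull.eq_interp h1]
      exact h3.le
  · set F := s.erase x with hF
    have hsF : insert x F = s := Finset.insert_erase hxs
    have hxF : x ∉ F := Finset.notMem_erase _ _
    have hFV : F ⊆ V := fun v hv => (Finset.mem_insert.1 (hsV (Finset.mem_of_mem_erase hv))
      ).resolve_left (Finset.ne_of_mem_erase hv)
    have hFcard : F.card = Module.finrank ℝ E := by
      rw [Finset.card_erase_of_mem hxs, hfull.2]; rfl
    have hFne : F.Nonempty := Finset.card_pos.1 (by omega)
    have hFX : F ∈ X.faces := X.down_closed hs (Finset.erase_subset _ _) hFne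
    have h1 : ∀ v ∈ F, l v = w v := fun v hv => by
      rw [hl1 v (Finset.mem_of_mem_erase hv), Function.update_of_ne (hne v (hFV hv))]
    have hlx : l x = t := by simpa using hl1 x hxs
    have h2 : ∀ v ∈ V, v ∉ F → l v < w v := fun v hv hvs => by
      have := hl2 v (Finset.mem_insert_of_mem hv) fun h =>
        hvs (Finset.mem_erase.2 ⟨hne v hv, h⟩)
      rwa [Function.update_of_ne (hne v hv)] at this
    have hcert : ∀ l' : E →ᵃ[ℝ] ℝ, (∀ v ∈ F, l' v = w v) → l' x = t' →
        (∀ v ∈ V, v ∉ F → l' v < w v) → False := fun l' e1 e2 e3 =>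
      hnc (cert_insert h.notMem (fun v hv hvx => e1 v (Finset.mem_erase.2 ⟨hvx, hv⟩))
        (fun _ => e2) (fun h => absurd hxs h)
        fun v hv hvs => e3 v hv fun h => hvs (Finset.mem_of_mem_erase h))
    have hFM : F ∉ M := fun hFM => by
      obtain ⟨k, hk1, hk2, hk3⟩ := h.below F hFM
      have hpos : 0 < t - k x := by linarith
      set θ := (t - t') / (t - k x) with hθ
      have hθ0 : 0 ≤ θ := div_nonneg (by linarith) hpos.le
      have hθ1 : θ < 1 := (div_lt_one hpos).2 (by linarith)
      have hθe : θ * (t - k x) = t - t' := div_mul_cancel₀ _ hpos.ne'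
      refine hcert ((1 - θ) • l + θ • k) (fun v hv => ?_) ?_ fun v hv hvF => ?_
      · simp [h1 v hv, hk1 v hv]; ring
      · simp only [AffineMap.coe_add, AffineMap.coe_smul, Pi.add_apply, Pi.smul_apply,
          smul_eq_mul, hlx]
        linarith
      · simp only [AffineMap.coe_add, AffineMap.coe_smul, Pi.add_apply, Pi.smul_apply, smul_eq_mul]
        nlinarith [h2 v hv hvF, hk2 v hv hvF]
    obtain ⟨q, hq⟩ := exists_posComb hFne
    have hqi : q ∈ interior T.space := by
      rw [← hX.space_eq]
      exact mem_interior_of_frontier hX.subset h.down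
        (by rw [hX.space_eq]; exact h.frontier_subset) hFX hFM hq
    set γ := coord s x with hγ
    have hγx : γ x = 1 := hfull.coord_self hxs
    have hγF : ∀ v ∈ F, γ v = 0 := fun v hv =>
      hfull.coord_of_ne hxs (Finset.mem_of_mem_erase hv) (Finset.ne_of_mem_erase hv).symm
    set N := V.filter fun v => γ v < 0 with hN
    have hNF : ∀ v ∈ N, v ∉ F := fun v hv hvF => by
      have := (Finset.mem_filter.1 hv).2
      rw [hγF v hvF] at this
      exact lt_irrefl _ this
    obtain ⟨v₁, hv₁, hle⟩ : ∃ v ∈ N, w v - l v ≤ (t - t') * -γ v := by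
      by_contra! hcon
      refine hcert (l - (t - t') • γ) (fun v hv => ?_) ?_ fun v hv hvF => ?_
      · simp [h1 v hv, hγF v hv]
      · simp [hlx, hγx]
      · simp only [AffineMap.coe_sub, AffineMap.coe_smul, Pi.sub_apply, Pi.smul_apply, smul_eq_mul]
        by_cases hγv : γ v < 0
        · linarith [hcon v (Finset.mem_filter.2 ⟨hv, hγv⟩)]
        · nlinarith [h2 v hv hvF]
    obtain ⟨v₀, hv₀, hmin⟩ := N.exists_min_image (fun v => (w v - l v) / -γ v) ⟨v₁, hv₁⟩
    set d := (w v₀ - l v₀) / -γ v₀ with hd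
    have hdN : ∀ v ∈ N, d * -γ v ≤ w v - l v := fun v hv => by
      have := hmin v hv
      rwa [le_div_iff₀ (by linarith [(Finset.mem_filter.1 hv).2])] at this
    have hγ0 : γ v₀ < 0 := (Finset.mem_filter.1 hv₀).2
    have hv₀V : v₀ ∈ V := (Finset.mem_filter.1 hv₀).1
    have hd0 : 0 < d := div_pos (by linarith [h2 v₀ hv₀V (hNF v₀ hv₀)]) (by linarith)
    have hdt : d ≤ t - t' := by
      have hγ1 := (Finset.mem_filter.1 hv₁).2
      have := (hdN v₁ hv₁).trans hle
      exact le_of_mul_le_mul_right this (by linarith)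
    have hde : d * -γ v₀ = w v₀ - l v₀ := div_mul_cancel₀ _ (by linarith)
    have k1 : ∀ v ∈ insert v₀ F, (l - d • γ) v = w v := fun v hv => by
      simp only [AffineMap.coe_sub, AffineMap.coe_smul, Pi.sub_apply, Pi.smul_apply, smul_eq_mul]
      rcases Finset.mem_insert.1 hv with rfl | hv
      · linarith
      · rw [h1 v hv, hγF v hv]; ring
    have k2 : ∀ v ∈ V, (l - d • γ) v ≤ w v := fun v hv => by
      simp only [AffineMap.coe_sub, AffineMap.coe_smul, Pi.sub_apply, Pi.smul_apply, smul_eq_mul]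
      by_cases hγv : γ v < 0
      · linarith [hdN v (Finset.mem_filter.2 ⟨hv, hγv⟩)]
      · by_cases hvF : v ∈ F
        · rw [h1 v hvF, hγF v hvF]; simp
        · nlinarith [h2 v hv hvF]
    obtain ⟨y, hy, hyT⟩ : ∃ y, PosComb (insert v₀ F) y ∧ y ∈ T.space := by
      have hc : Continuous fun θ : ℝ => (1 - θ) • q + θ • v₀ := by fun_prop
      have e1 : ∀ᶠ θ : ℝ in nhdsWithin 0 (Ioi 0), (1 - θ) • q + θ • v₀ ∈ interior T.space :=
        Filter.Eventually.filter_mono nhdsWithin_le_nhds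
          (hc.tendsto 0 (isOpen_interior.mem_nhds (by simpa using hqi)))
      have e2 : ∀ᶠ θ : ℝ in nhdsWithin 0 (Ioi 0), θ < 1 :=
        Filter.Eventually.filter_mono nhdsWithin_le_nhds (gt_mem_nhds one_pos)
      obtain ⟨θ, ⟨hθ, hθ1⟩, hθ0⟩ := ((e1.and e2).and self_mem_nhdsWithin).exists
      exact ⟨_, hq.insert (hNF v₀ hv₀) hθ0 hθ1, interior_subset hθ⟩
    have hrT : insert v₀ F ∈ T.faces :=
      h.certified.mem_faces k1 k2 (Finset.insert_subset hv₀V hFV) hy hyT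
    have hrf : FullSimplex (insert v₀ F) :=
      ⟨T.indep hrT, by rw [Finset.card_insert_of_notMem (hNF v₀ hv₀), hFcard]⟩
    have e : interp (insert v₀ F) w x = t - d := by
      rw [← hrf.eq_interp k1]
      simp [hlx, hγx]
    refine ⟨_, hrT, hrf, by linarith, by linarith,
      Or.inr ⟨v₀, Finset.mem_insert_self _ _, ?_⟩⟩
    rw [Finset.erase_insert (hNF v₀ hv₀), hsF]

theorem Insertable.exists_superset (h : Insertable V w T M x c)
    (hX : InsertState V w T M x t X) {s : Finset E} (hs : s ∈ X.faces) (hsM : s ∉ M) :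
    ∃ r ∈ X.faces, FullSimplex r ∧ s ⊆ r :=
  exists_fullSimplex_superset hX.certified.finite hX.subset h.down
    (by rw [hX.space_eq]; exact h.frontier_subset) hs hsM

/-- The complex does not change as long as no critical value is passed. -/
theorem Insertable.lower (h : Insertable V w T M x c) (hE : 0 < Module.finrank ℝ E)
    (hX : InsertState V w T M x t X) (hct : c ≤ t') (htt : t' ≤ t)
    (hcrit : ∀ r ∈ T.faces, FullSimplex r → interp r w x < t' ∨ t < interp r w x) :
    InsertState V w T M x t' X := by
  refine ⟨⟨hX.certified.subset, fun s hs => ?_⟩, hX.space_eq, hX.subset⟩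
  by_cases hsM : s ∈ M
  · exact h.cert_of_mem hct hsM
  · obtain ⟨r, hr, hrf, hsr⟩ := h.exists_superset hX hs hsM
    refine Cert.mono ?_ hrf.1 hsr
    by_contra hnc
    obtain ⟨q, hq, hqf, h1, h2, -⟩ := h.persist hE hX hct htt hr hrf hnc
    rcases hcrit q hq hqf with h3 | h3 <;> linarith

end Insert

section Flip

variable [FiniteDimensional ℝ E] {V : Finset E} {w : E → ℝ} {T X : Geometry.SimplicialComplex ℝ E}
  {M : Set (Finset E)} {x : E} {c t t' : ℝ}

/-- Passing a critical value amounts to a bistellar move. -/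
theorem Insertable.flip (h : Insertable V w T M x c) (hE : 0 < Module.finrank ℝ E)
    {s : Finset E} (hs : s ∈ T.faces) (hf : FullSimplex s) {δ : ℝ} (hδ : 0 < δ)
    (hc : c ≤ interp s w x - δ)
    (hcrit : ∀ r ∈ T.faces, FullSimplex r → interp s w x - δ ≤ interp r w x →
      interp r w x ≤ interp s w x + δ → r = s)
    (hsmall : ∀ u ∈ s, ∀ v ∈ V, v ∉ s →
      interp s w v + δ * (coord s u v / coord s u x) < w v ∧
      interp s w v - δ * (coord s u v / coord s u x) < w v)
    (hX : InsertState V w T M x (interp s w x + δ) X) :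
    ∃ X', InsertState V w T M x (interp s w x - δ) X' ∧
      BistellarMove (Module.finrank ℝ E) X X' := by
  set l := interp s w with hl
  have hsV : s ⊆ V := h.certified.subset s hs
  have hxs : x ∉ s := fun hx => h.notMem (hsV hx)
  have hls : ∀ v ∈ s, l v = w v := fun v hv => hf.interp_of_mem w hv
  have hlV : ∀ v ∈ V, v ∉ s → l v < w v := fun v hv hvs => by
    obtain ⟨l', h1, h2⟩ := h.certified.cert s hs
    rw [hl, ← hf.eq_interp h1]
    exact h2 v hv hvs
  have hne : ∀ u ∈ s, coord s u x ≠ 0 := h.coord_ne_zero s hs hf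
  obtain ⟨-, hsum, hsmul⟩ := hf.coord_spec
  obtain ⟨p, hpA, hpB⟩ := exists_circuit hxs hne (hsum x) (hsmul x)
  set A := s.filter fun u => 0 < coord s u x with hA
  set B := s.filter fun u => coord s u x < 0 with hB
  have hdAB : Disjoint A B := Finset.disjoint_filter.2 fun u _ h1 h2 => lt_asymm h1 h2
  have hAB : A ∪ B = s := by
    rw [hA, hB, ← Finset.filter_or]
    exact Finset.filter_true_of_mem fun u hu => (hne u hu).symm.lt_or_gt
  have hxA : x ∉ A := fun h => hxs (Finset.mem_filter.1 h).1
  have hxB : x ∉ B := fun h => hxs (Finset.mem_filter.1 h).1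
  have hd : Disjoint A (insert x B) := Finset.disjoint_insert_right.2 ⟨hxA, hdAB⟩
  have hZ : A ∪ insert x B = insert x s := by rw [Finset.union_insert, hAB]
  have hcard : A.card + (insert x B).card = Module.finrank ℝ E + 2 := by
    rw [Finset.card_insert_of_notMem hxB, ← add_assoc, ← Finset.card_union_of_disjoint hdAB, hAB,
      hf.2]
  have hsT : ∀ {y}, y ∈ convexHull ℝ (s : Set E) → y ∈ X.space := fun hy => by
    rw [hX.space_eq]
    exact T.convexHull_subset_space hs hy
  have happ : ∀ (e : ℝ) (u v : E), (l + e • (coord s u x)⁻¹ • coord s u) v =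
      l v + e * (coord s u v / coord s u x) := fun e u v => by
    simp [div_eq_inv_mul]
  have hcertZ : ∀ (e : ℝ), (e = δ ∨ e = -δ) → ∀ u ∈ s, e * (coord s u x)⁻¹ < 0 →
      Cert (insert x V) (Function.update w x (l x + e)) (insert x (s.erase u)) := by
    intro e he u hu hneg
    refine cert_insert (l := l + e • (coord s u x)⁻¹ • coord s u) h.notMem (fun v hv hvx => ?_)
      (fun _ => ?_) (fun h => absurd (Finset.mem_insert_self _ _) h) fun v hv hvs => ?_
    · have hv := Finset.mem_erase.1 ((Finset.mem_insert.1 hv).resolve_left hvx)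
      rw [happ, hls v hv.2, hf.coord_of_ne hu hv.2 hv.1.symm]
      simp
    · rw [happ, div_self (hne u hu), mul_one]
    · rw [happ]
      by_cases hvu : v ∈ s
      · have : v = u := by
          by_contra hvu'
          exact hvs (Finset.mem_insert_of_mem (Finset.mem_erase.2 ⟨hvu', hvu⟩))
        subst this
        rw [hls v hvu, hf.coord_self hvu, one_div]
        linarith
      · have := hsmall u hu v hv hvu
        rcases he with rfl | rfl
        · exact this.1
        · linarith [this.2]
  have herase : ∀ u ∈ s, (insert x s).erase u = insert x (s.erase u) := fun u hu =>
    Finset.erase_insert_of_ne (by rintro rfl; exact hxs hu)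
  have hmem : p ∈ interior (convexHull ℝ (A ∪ (insert x B : Finset E) : Set E)) := by
    rw [← Finset.coe_union]
    exact hf.mem_interior (by rw [hZ]; exact Finset.subset_insert _ _) (hpA.union hd hpB)
  refine Exists.elim (exists_flip (n := Module.finrank ℝ E) (p := p)
    (w₂ := Function.update w x (l x - δ)) hX.certified hd hcard hpA hpB hmem ?_ ?_ ?_ ?_ ?_)
    fun X' ⟨hX', hsp, hmove, hkeep⟩ => ⟨X', ⟨hX', hsp.trans hX.space_eq, fun m hm =>
      hkeep m (hX.subset hm) (h.cert_of_mem hc hm)⟩, hmove⟩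
  · rw [hZ]
    exact Finset.insert_subset_insert _ hsV
  · intro b hb
    rw [hZ]
    rcases Finset.mem_insert.1 hb with rfl | hb
    · rw [Finset.erase_insert hxs]
      obtain ⟨y, hy⟩ := exists_posComb (T.nonempty_of_mem_faces hs)
      refine hX.certified.mem_faces_of_cert (cert_insert (l := l) h.notMem (fun v hv _ => hls v hv)
        (fun h => absurd h hxs) (fun _ => by linarith) hlV) (hsV.trans (Finset.subset_insert _ _)) hy
        (hsT hy.mem_convexHull)
    · obtain ⟨hbs, hb0⟩ := Finset.mem_filter.1 hb
      rw [herase b hbs]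
      have hFne : (s.erase b).Nonempty := Finset.card_pos.1 (by
        rw [Finset.card_erase_of_mem hbs, hf.2]; omega)
      have hFT := T.down_closed hs (Finset.erase_subset b s) hFne
      have hFM : s.erase b ∉ M := fun hFM => by
        obtain ⟨k, hk1, hk2, hk3⟩ := h.below _ hFM
        have : l x ≤ k x := by
          rw [hl, interp_apply, hf.apply_eq k]
          refine Finset.sum_le_sum fun u hu => ?_
          by_cases hub : u = b
          · rw [hub]
            exact mul_le_mul_of_nonpos_left (hk2 b (hsV hbs) (Finset.notMem_erase _ _)).le hb0.le
          · rw [hk1 u (Finset.mem_erase.2 ⟨hub, hu⟩)]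
        linarith
      obtain ⟨q, hq⟩ := exists_posComb hFne
      have hqi := mem_interior_of_frontier h.subset h.down h.frontier_subset hFT hFM hq
      have hct : Continuous fun θ : ℝ => (1 - θ) • q + θ • x := by fun_prop
      have e1 : ∀ᶠ θ : ℝ in nhdsWithin 0 (Ioi 0), (1 - θ) • q + θ • x ∈ interior T.space :=
        Filter.Eventually.filter_mono nhdsWithin_le_nhds
          (hct.tendsto 0 (isOpen_interior.mem_nhds (by simpa using hqi)))
      have e2 : ∀ᶠ θ : ℝ in nhdsWithin 0 (Ioi 0), θ < 1 :=
        Filter.Eventually.filter_mono nhdsWithin_le_nhds (gt_mem_nhds one_pos)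
      obtain ⟨θ, ⟨hθ, hθ1⟩, hθ0⟩ := ((e1.and e2).and self_mem_nhdsWithin).exists
      refine hX.certified.mem_faces_of_cert (hcertZ δ (Or.inl rfl) b hbs
        (mul_neg_of_pos_of_neg hδ (inv_lt_zero.2 hb0)))
        (Finset.insert_subset_insert _ ((Finset.erase_subset _ _).trans hsV))
        (hq.insert (fun h => hxs (Finset.mem_of_mem_erase h)) hθ0 hθ1) ?_
      rw [hX.space_eq]
      exact interior_subset hθ
  · intro a ha
    obtain ⟨has, ha0⟩ := Finset.mem_filter.1 ha
    rw [hZ, herase a has, sub_eq_add_neg]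
    exact hcertZ (-δ) (Or.inr rfl) a has (mul_neg_of_neg_of_pos (by linarith) (inv_pos.2 ha0))
  · intro a ha
    obtain ⟨has, ha0⟩ := Finset.mem_filter.1 ha
    rw [hZ, herase a has]
    refine affineIndependent_of_dual fun u hu => ?_
    rcases Finset.mem_insert.1 hu with rfl | hu
    · refine ⟨coord s a, ha0, fun v hv hvx => ?_⟩
      have hv := Finset.mem_erase.1 ((Finset.mem_insert.1 hv).resolve_left hvx)
      exact hf.coord_of_ne has hv.2 hv.1.symm
    · obtain ⟨hua, hus⟩ := Finset.mem_erase.1 hu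
      refine ⟨coord s u - (coord s u x / coord s a x) • coord s a, ?_, fun v hv hvu => ?_⟩
      · simp [hf.coord_self hus, hf.coord_of_ne has hus hua.symm]
      · rcases Finset.mem_insert.1 hv with rfl | hv
        · simp [ha0.ne']
        · obtain ⟨hva, hvs⟩ := Finset.mem_erase.1 hv
          simp [hf.coord_of_ne hus hvs hvu.symm, hf.coord_of_ne has hvs hva.symm]
  · intro r hr _
    by_cases hrM : r ∈ M
    · exact Or.inr (h.cert_of_mem hc hrM)
    · obtain ⟨q, hq, hqf, hrq⟩ := h.exists_superset hX hr hrM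
      by_cases hcq : Cert (insert x V) (Function.update w x (l x - δ)) q
      · exact Or.inr (hcq.mono hqf.1 hrq)
      · obtain ⟨q', hq', hqf', h1, h2, h3⟩ :=
          h.persist hE hX hc (by linarith) hq hqf hcq
        obtain rfl := hcrit q' hq' hqf' h1 h2
        left
        rw [hZ]
        refine hrq.trans ?_
        rcases h3 with rfl | ⟨v, _, rfl⟩
        · exact Finset.subset_insert _ _
        · exact Finset.insert_subset_insert _ (Finset.erase_subset _ _)

theorem Insertable.eventually_flip (h : Insertable V w T M x c) (hE : 0 < Module.finrank ℝ E)
    {s : Finset E} (hs : s ∈ T.faces) (hf : FullSimplex s) (hc : c < interp s w x)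
    (ht : interp s w x < t) :
    ∃ δ : ℝ, 0 < δ ∧ c ≤ interp s w x - δ ∧ interp s w x + δ ≤ t ∧
      (∀ r ∈ T.faces, FullSimplex r → interp s w x - δ ≤ interp r w x →
        interp r w x ≤ interp s w x + δ → r = s) ∧
      ∀ X, InsertState V w T M x (interp s w x + δ) X →
        ∃ X', InsertState V w T M x (interp s w x - δ) X' ∧
          BistellarMove (Module.finrank ℝ E) X X' := by
  have hlV : ∀ v ∈ V, v ∉ s → interp s w v < w v := fun v hv hvs => by
    obtain ⟨l', h1, h2⟩ := h.certified.cert s hs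
    rw [← hf.eq_interp h1]
    exact h2 v hv hvs
  have e1 : ∀ k : ℝ → ℝ, Continuous k → 0 < k 0 →
      ∀ᶠ δ : ℝ in nhdsWithin 0 (Ioi 0), 0 < k δ := fun k hk h0 =>
    Filter.Eventually.filter_mono nhdsWithin_le_nhds (hk.tendsto 0 (lt_mem_nhds h0))
  have e2 := e1 (fun δ => interp s w x - δ - c) (by fun_prop) (by simpa using hc)
  have e3 := e1 (fun δ => t - (interp s w x + δ)) (by fun_prop) (by simpa using ht)
  have e4 : ∀ᶠ δ : ℝ in nhdsWithin 0 (Ioi 0), ∀ r ∈ {r ∈ T.faces | FullSimplex r ∧ r ≠ s},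
      0 < |interp r w x - interp s w x| - δ :=
    (Filter.eventually_all_finite (h.certified.finite.subset fun r hr => hr.1)).2
      fun r hr => e1 _ (by fun_prop) (by
        simpa [sub_eq_zero] using fun h' => hr.2.2 (h.interp_injOn r hr.1 hr.2.1 s hs hf h'))
  have e5 : ∀ᶠ δ : ℝ in nhdsWithin 0 (Ioi 0), ∀ u ∈ s, ∀ v ∈ V.filter fun v => v ∉ s,
      0 < w v - (interp s w v + δ * (coord s u v / coord s u x)) ∧
      0 < w v - (interp s w v - δ * (coord s u v / coord s u x)) := by
    refine (Filter.eventually_all_finset _).2 fun u _ =>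
      (Filter.eventually_all_finset _).2 fun v hv => ?_
    obtain ⟨hv, hvs⟩ := Finset.mem_filter.1 hv
    exact (e1 _ (by fun_prop) (by simpa using hlV v hv hvs)).and
      (e1 _ (by fun_prop) (by simpa using hlV v hv hvs))
  obtain ⟨δ, ⟨⟨⟨h2, h3⟩, h4⟩, h5⟩, hδ⟩ :=
    ((((e2.and e3).and e4).and e5).and self_mem_nhdsWithin).exists
  have hcrit : ∀ r ∈ T.faces, FullSimplex r → interp s w x - δ ≤ interp r w x →
      interp r w x ≤ interp s w x + δ → r = s := fun r hr hrf k1 k2 => by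
    by_contra hrs
    have := h4 r ⟨hr, hrf, hrs⟩
    have : |interp r w x - interp s w x| ≤ δ := abs_le.2 ⟨by linarith, by linarith⟩
    linarith
  refine ⟨δ, hδ, by linarith, by linarith, hcrit, fun X hX =>
    h.flip hE hs hf hδ (by linarith) hcrit (fun u hu v hv hvs => ?_) hX⟩
  have := h5 u hu v (Finset.mem_filter.2 ⟨hv, hvs⟩)
  exact ⟨by linarith [this.1], by linarith [this.2]⟩

theorem Insertable.exists_path_of_state (h : Insertable V w T M x c)
    (hE : 0 < Module.finrank ℝ E) (k : ℕ) : ∀ (t : ℝ) (X : Geometry.SimplicialComplex ℝ E),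
      c ≤ t → InsertState V w T M x t X →
      (∀ r ∈ T.faces, FullSimplex r → interp r w x ≠ t) →
      (h.certified.finite.toFinset.filter fun r =>
        FullSimplex r ∧ c < interp r w x ∧ interp r w x < t).card = k →
      ∃ X', InsertState V w T M x c X' ∧ BistellarPath (Module.finrank ℝ E) M X X' := by
  induction k using Nat.strong_induction_on with
  | _ k ih =>
  intro t X hct hX ht hk
  set S := h.certified.finite.toFinset.filter fun r =>
    FullSimplex r ∧ c < interp r w x ∧ interp r w x < t with hS
  have hmem : ∀ r, r ∈ S ↔ r ∈ T.faces ∧ FullSimplex r ∧ c < interp r w x ∧ interp r w x < t := by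
    simp [hS]
  rcases S.eq_empty_or_nonempty with h0 | h0
  · refine ⟨X, h.lower hE hX le_rfl hct fun r hr hrf => ?_, .refl⟩
    by_contra! hcon
    have := (hmem r).2 ⟨hr, hrf, lt_of_le_of_ne hcon.1 (h.interp_ne r hr hrf).symm,
      lt_of_le_of_ne hcon.2 (ht r hr hrf)⟩
    simp [h0] at this
  · obtain ⟨s, hs, hmax⟩ := S.exists_max_image (fun r => interp r w x) h0
    obtain ⟨hsT, hsf, hcs, hst⟩ := (hmem s).1 hs
    obtain ⟨δ, hδ, hδc, hδt, hcrit, hflip⟩ := h.eventually_flip hE hsT hsf hcs hst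
    have hX1 := h.lower hE hX (t' := interp s w x + δ) (by linarith) hδt fun r hr hrf => by
      by_contra! hcon
      have := hmax r ((hmem r).2 ⟨hr, hrf, by linarith, lt_of_le_of_ne hcon.2 (ht r hr hrf)⟩)
      linarith
    obtain ⟨X1, hX1', hmove⟩ := hflip X hX1
    obtain ⟨X', hX', hpath⟩ := ih _ (by
      rw [← hk]
      refine Finset.card_lt_card (t := S) (s := h.certified.finite.toFinset.filter fun r =>
        FullSimplex r ∧ c < interp r w x ∧ interp r w x < interp s w x - δ)
        ⟨fun r hr => ?_, fun hsub => ?_⟩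
      · simp only [Finset.mem_filter, Set.Finite.mem_toFinset] at hr
        exact (hmem r).2 ⟨hr.1, hr.2.1, hr.2.2.1, by linarith [hr.2.2.2]⟩
      · have := hsub hs
        simp only [Finset.mem_filter, Set.Finite.mem_toFinset] at this
        linarith [this.2.2.2]) (interp s w x - δ) X1 hδc hX1' (fun r hr hrf hr' => by
        obtain rfl := hcrit r hr hrf hr'.ge (by linarith)
        linarith) rfl
    exact ⟨X', hX', .head ⟨hmove, hX.subset, hX1'.subset⟩ hpath⟩

/-- A generic point can be inserted by bistellar moves. -/
theorem Insertable.exists_path (h : Insertable V w T M x c) (hE : 0 < Module.finrank ℝ E) :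
    ∃ X, InsertState V w T M x c X ∧ BistellarPath (Module.finrank ℝ E) M T X := by
  have hl : ∀ s, ∃ l : E →ᵃ[ℝ] ℝ, s ∈ T.faces → (∀ v ∈ s, l v = w v) ∧
      ∀ v ∈ V, v ∉ s → l v < w v := fun s => by
    by_cases hs : s ∈ T.faces
    · obtain ⟨l, hl⟩ := h.certified.cert s hs
      exact ⟨l, fun _ => hl⟩
    · exact ⟨0, fun h => absurd h hs⟩
  choose l hl using hl
  obtain ⟨b, hb⟩ := (h.certified.finite.image fun s => l s x).bddAbove
  have hlt : ∀ s ∈ T.faces, l s x < max c b + 1 := fun s hs =>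
    ((hb (mem_image_of_mem _ hs)).trans (le_max_right c b)).trans_lt (lt_add_one _)
  have hX : InsertState V w T M x (max c b + 1) T := by
    refine ⟨⟨fun s hs => (h.certified.subset s hs).trans (Finset.subset_insert _ _),
      fun s hs => ?_⟩, rfl, h.subset⟩
    have hxs : x ∉ s := fun hxs => h.notMem (h.certified.subset s hs hxs)
    exact cert_insert h.notMem (fun v hv _ => (hl s hs).1 v hv) (fun h => absurd h hxs)
      (fun _ => hlt s hs) (hl s hs).2
  refine h.exists_path_of_state hE _ _ T (by linarith [le_max_left c b]) hX
    (fun r hr hrf => ?_) rfl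
  rw [← hrf.eq_interp (hl r hr).1]
  exact (hlt r hr).ne

end Flip

/-! ### Common refinement by insertion of the same points -/

section Family

variable [FiniteDimensional ℝ E] {P : Set E} {M : Set (Finset E)} {l : Finset E → E →ᵃ[ℝ] ℝ}

theorem exists_insertable (hE : 0 < Module.finrank ℝ E)
    (hdown : ∀ m ∈ M, ∀ t ⊆ m, t.Nonempty → t ∈ M)
    (hfr : frontier P ⊆ ⋃ m ∈ M, convexHull ℝ (m : Set E))
    {U : Set E} {a b : ℝ} (hU : IsOpen U) (hne : U.Nonempty) (hab : a < b)
    (hUM : ∀ x ∈ U, ∀ m ∈ M, l m x < a) {V : Bool → Finset E} {w : Bool → E → ℝ}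
    {T : Bool → Geometry.SimplicialComplex ℝ E} (hT : ∀ i, Certified (V i) (w i) (T i))
    (hTP : ∀ i, (T i).space = P) (hMT : ∀ i, M ⊆ (T i).faces)
    (hl : ∀ m ∈ M, ∀ i, (∀ v ∈ m, l m v = w i v) ∧ ∀ v ∈ V i, v ∉ m → l m v < w i v) :
    ∃ x ∈ U, ∃ c ∈ Ioo a b, ∀ i, Insertable (V i) (w i) (T i) M x c := by
  have : Nontrivial E := Module.finrank_pos_iff.1 hE
  have r1 : ∀ᶠ x in residual E, ∀ i, ∀ v ∈ V i, x ≠ v :=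
    Filter.eventually_all.2 fun i => (Filter.eventually_all_finset _).2 fun v _ =>
      residual_of_dense_open isOpen_compl_singleton (dense_compl_singleton v)
  have r2 : ∀ᶠ x in residual E, ∀ i, ∀ s ∈ (T i).faces, FullSimplex s → ∀ u ∈ s,
      coord s u x ≠ 0 := by
    refine Filter.eventually_all.2 fun i => (Filter.eventually_all_finite (hT i).finite).2
      fun s _ => Filter.eventually_imp_distrib_left.2 fun hf =>
        (Filter.eventually_all_finset _).2 fun u hu => eventually_residual_ne_zero ⟨u, ?_⟩
    rw [hf.coord_self hu]
    exact one_ne_zero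
  have r3 : ∀ᶠ x in residual E, ∀ i, ∀ s ∈ (T i).faces, ∀ s' ∈ (T i).faces,
      FullSimplex s ∧ FullSimplex s' ∧ s ≠ s' → (interp s (w i) - interp s' (w i)) x ≠ 0 := by
    refine Filter.eventually_all.2 fun i => (Filter.eventually_all_finite (hT i).finite).2
      fun s hs => (Filter.eventually_all_finite (hT i).finite).2 fun s' hs' =>
        Filter.eventually_imp_distrib_left.2 fun ⟨hf, hf', hss⟩ => eventually_residual_ne_zero ?_
    obtain ⟨v, hv, hvs⟩ : ∃ v ∈ s', v ∉ s := by
      by_contra! hsub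
      exact hss (Finset.eq_of_subset_of_card_le hsub (by rw [hf.2, hf'.2])).symm
    obtain ⟨k, hk1, hk2⟩ := (hT i).cert s hs
    refine ⟨v, ?_⟩
    have := hk2 v ((hT i).subset s' hs' hv) hvs
    rw [hf.eq_interp hk1] at this
    simpa [hf'.interp_of_mem (w i) hv] using (sub_neg.2 this).ne
  obtain ⟨x, hxU, h1, h2, h3⟩ := exists_mem_of_eventually_residual (r1.and (r2.and r3)) hU hne
  have hfin : (⋃ i, (fun s => interp s (w i) x) '' (T i).faces).Finite :=
    finite_iUnion fun i => (hT i).finite.image _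
  obtain ⟨c, hc, hcf⟩ := (Ioo_infinite hab).exists_notMem_finite hfin
  refine ⟨x, hxU, c, hc, fun i => ?_⟩
  exact
    { certified := hT i
      notMem := fun hx => h1 i x hx rfl
      subset := hMT i
      down := hdown
      frontier_subset := by rw [hTP]; exact hfr
      below := fun m hm => ⟨l m, (hl m hm i).1, (hl m hm i).2, (hUM x hxU m hm).trans hc.1⟩
      coord_ne_zero := h2 i
      interp_injOn := fun s hs hf s' hs' hf' he => by
        by_contra hss
        exact h3 i s hs s' hs' ⟨hf, hf', hss⟩ (by simp [he])
      interp_ne := fun s hs _ he => hcf (mem_iUnion.2 ⟨i, s, hs, he⟩) }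

/-- Points can be inserted into two complexes simultaneously. -/
theorem exists_insert_family {ι : Type*} (hE : 0 < Module.finrank ℝ E)
    (hdown : ∀ m ∈ M, ∀ t ⊆ m, t.Nonempty → t ∈ M)
    (hfr : frontier P ⊆ ⋃ m ∈ M, convexHull ℝ (m : Set E)) (J : Finset ι)
    {U : ι → Set E} {a b : ι → ℝ} (hJ : ∀ j ∈ J, IsOpen (U j) ∧ (U j).Nonempty ∧
      a j < b j ∧ ∀ x ∈ U j, ∀ m ∈ M, l m x < a j) :
    ∀ (V : Bool → Finset E) (w : Bool → E → ℝ) (T : Bool → Geometry.SimplicialComplex ℝ E),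
      (∀ i, Certified (V i) (w i) (T i)) → (∀ i, (T i).space = P) → (∀ i, M ⊆ (T i).faces) →
      (∀ m ∈ M, ∀ i, (∀ v ∈ m, l m v = w i v) ∧ ∀ v ∈ V i, v ∉ m → l m v < w i v) →
      ∃ (X : Finset E) (w' : Bool → E → ℝ) (T' : Bool → Geometry.SimplicialComplex ℝ E),
        (∀ i, Certified (V i ∪ X) (w' i) (T' i)) ∧ (∀ i, (T' i).space = P) ∧
        (∀ i, BistellarPath (Module.finrank ℝ E) M (T i) (T' i)) ∧
        (∀ i, ∀ v ∈ V i, w' i v = w i v) ∧ (∀ i j, ∀ v ∈ X, w' i v = w' j v) ∧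
        ∀ j ∈ J, ∃ x ∈ X, x ∈ U j ∧ ∀ i, w' i x < b j := by
  induction J using Finset.induction_on with
  | empty =>
    intro V w T hT hTP hMT hl
    exact ⟨∅, w, T, by simpa using hT, hTP, fun _ => .refl, by simp, by simp, by simp⟩
  | insert j J hj ih =>
    intro V w T hT hTP hMT hl
    obtain ⟨hU, hne, hab, hUM⟩ := hJ j (Finset.mem_insert_self _ _)
    obtain ⟨x, hx, c, hc, hins⟩ := exists_insertable hE hdown hfr hU hne hab hUM hT hTP hMT hl
    choose T₁ hT₁ hpath using fun i => (hins i).exists_path hE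
    obtain ⟨X, w', T', g1, g2, g3, g4, g5, g6⟩ := ih (fun j hj => hJ j (Finset.mem_insert_of_mem hj))
      (fun i => insert x (V i)) (fun i => Function.update (w i) x c) T₁
      (fun i => (hT₁ i).certified) (fun i => (hT₁ i).space_eq.trans (hTP i))
      (fun i => (hT₁ i).subset) fun m hm i => by
        have hne : ∀ v ∈ V i, v ≠ x := fun v hv => by rintro rfl; exact (hins i).notMem hv
        refine ⟨fun v hv => ?_, fun v hv hvm => ?_⟩
        · rw [Function.update_of_ne (hne v ((hT i).subset m (hMT i hm) hv)), (hl m hm i).1 v hv]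
        · rcases Finset.mem_insert.1 hv with rfl | hv
          · rw [Function.update_self]
            exact (hUM v hx m hm).trans hc.1
          · rw [Function.update_of_ne (hne v hv)]
            exact (hl m hm i).2 v hv hvm
    have hwx : ∀ i, w' i x = c := fun i => by
      rw [g4 i x (Finset.mem_insert_self _ _), Function.update_self]
    refine ⟨insert x X, w', T', fun i => ?_, g2, fun i => (hpath i).trans (g3 i), fun i v hv => ?_,
      fun i k v hv => ?_, fun k hk => ?_⟩
    · have := g1 i
      rwa [Finset.insert_union, ← Finset.union_insert] at this
    · rw [g4 i v (Finset.mem_insert_of_mem hv), Function.update_of_ne]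
      rintro rfl
      exact (hins i).notMem hv
    · rcases Finset.mem_insert.1 hv with rfl | hv
      · rw [hwx, hwx]
      · exact g5 i k v hv
    · rcases Finset.mem_insert.1 hk with rfl | hk
      · exact ⟨x, Finset.mem_insert_self _ _, hx, fun i => by rw [hwx]; exact hc.2⟩
      · obtain ⟨y, hy, h⟩ := g6 k hk
        exact ⟨y, Finset.mem_insert_of_mem hy, h⟩

end Family

/-- Open sets around `v` such that any choice of points in them surrounds `v`. -/
theorem exists_surrounding {n : ℕ} [NeZero n] (v : Fin n → ℝ) {r : ℝ} (hr : 0 < r) :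
    ∃ U : Fin n × Bool → Set (Fin n → ℝ), (∀ k, IsOpen (U k) ∧ (U k).Nonempty ∧
      U k ⊆ Metric.ball v r) ∧ ∀ (l : (Fin n → ℝ) →ᵃ[ℝ] ℝ) (x : Fin n × Bool → Fin n → ℝ),
        (∀ k, x k ∈ U k) → ∃ k, l v ≤ l (x k) := by
  have hn : (1 : ℝ) ≤ n := by exact_mod_cast NeZero.one_le
  have hη : 0 < r / (2 * n) := by positivity
  have hηr : r / (2 * n) ≤ r / 2 := div_le_div_of_nonneg_left hr.le two_pos (by linarith)
  set e : Fin n × Bool → Fin n → ℝ := fun k => Pi.single k.1 (if k.2 then r / 2 else -(r / 2))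
  refine ⟨fun k => Metric.ball (v + e k) (r / (2 * n)), fun k => ⟨Metric.isOpen_ball,
    Metric.nonempty_ball.2 hη, Metric.ball_subset_ball' ?_⟩, fun l x hx => ?_⟩
  · have : ‖e k‖ = r / 2 := by
      simp only [e, Pi.norm_single]
      split_ifs <;> simp [abs_of_pos hr]
    rw [dist_self_add_left, this]
    linarith
  · obtain ⟨j, -, hj⟩ := Finset.univ.exists_max_image
      (fun j : Fin n => |l.linear (Pi.single j 1)|) Finset.univ_nonempty
    refine ⟨(j, decide (0 ≤ l.linear (Pi.single j 1))), ?_⟩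
    set k := (j, decide (0 ≤ l.linear (Pi.single j 1)))
    have hd : l (x k) = l v + l.linear (e k) + l.linear (x k - (v + e k)) := by
      have h1 := l.linearMap_vsub (x k) v
      simp only [vsub_eq_sub] at h1
      have h2 : x k - v = e k + (x k - (v + e k)) := by abel
      rw [h2, map_add] at h1
      linarith
    have h1 : l.linear (e k) = r / 2 * |l.linear (Pi.single j 1)| := by
      have : e k = (if k.2 then r / 2 else -(r / 2)) • Pi.single j (1 : ℝ) := by
        simp only [e, k]
        rw [← Pi.single_smul]
        simp
      rw [this, map_smul, smul_eq_mul]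
      by_cases h0 : 0 ≤ l.linear (Pi.single j 1)
      · simp [k, h0, abs_of_nonneg h0]
      · simp [k, h0, abs_of_neg (not_le.1 h0)]
    have h2 : |l.linear (x k - (v + e k))| ≤ r / 2 * |l.linear (Pi.single j 1)| := by
      have hk : ‖x k - (v + e k)‖ ≤ r / (2 * n) := (mem_ball_iff_norm.1 (hx k)).le
      generalize x k - (v + e k) = z at hk
      rw [l.linear.pi_apply_eq_sum_univ z]
      calc |∑ i, z i • l.linear (fun j => if i = j then 1 else 0)|
          ≤ ∑ i, |z i • l.linear (fun j => if i = j then 1 else 0)| := Finset.abs_sum_le_sum_abs _ _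
        _ ≤ ∑ _i : Fin n, r / (2 * n) * |l.linear (Pi.single j 1)| := by
          refine Finset.sum_le_sum fun i _ => ?_
          rw [smul_eq_mul, abs_mul]
          refine mul_le_mul ((norm_le_pi_norm z i).trans hk) ?_ (abs_nonneg _) hη.le
          have : (fun j => if i = j then (1 : ℝ) else 0) = Pi.single i 1 := by
            ext j
            simp [Pi.single_apply, eq_comm]
          rw [this]
          exact hj i (Finset.mem_univ _)
        _ = r / 2 * |l.linear (Pi.single j 1)| := by
          rw [Finset.sum_const, Finset.card_univ, Fintype.card_fin, nsmul_eq_mul]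
          field_simp
    rw [hd, h1]
    linarith [neg_abs_le (l.linear (x k - (v + e k)))]

/-- Two lower envelope complexes with the same support which agree on a subcomplex covering the
frontier are related by bistellar moves. -/
theorem exists_path_of_certified [FiniteDimensional ℝ E] (hE : 0 < Module.finrank ℝ E)
    {κ : Type*} [Fintype κ] (hsur : ∀ (v : E) (r : ℝ), 0 < r → ∃ U : κ → Set E,
      (∀ k, IsOpen (U k) ∧ (U k).Nonempty ∧ U k ⊆ Metric.ball v r) ∧
      ∀ (l : E →ᵃ[ℝ] ℝ) (x : κ → E), (∀ k, x k ∈ U k) → ∃ k, l v ≤ l (x k)) {P : Set E}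
    {M : Set (Finset E)} (hdown : ∀ m ∈ M, ∀ t ⊆ m, t.Nonempty → t ∈ M)
    (hfr : frontier P ⊆ ⋃ m ∈ M, convexHull ℝ (m : Set E))
    {V : Bool → Finset E} {w : Bool → E → ℝ}
    {T : Bool → Geometry.SimplicialComplex ℝ E} (hT : ∀ i, Certified (V i) (w i) (T i))
    (hTP : ∀ i, (T i).space = P) (hMT : ∀ i, M ⊆ (T i).faces)
    {l : Finset E → E →ᵃ[ℝ] ℝ}
    (hl : ∀ m ∈ M, ∀ i, (∀ v ∈ m, l m v = w i v) ∧ ∀ v ∈ V i, v ∉ m → l m v < w i v)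
    (hw : ∀ i j v, {v} ∈ M → w i v = w j v) (i j : Bool) :
    BistellarPath (Module.finrank ℝ E) M (T i) (T j) := by
  have hball : ∀ i v, ∃ r a : ℝ, v ∈ V i → {v} ∉ M → 0 < r ∧ a < w i v ∧
      ∀ x ∈ Metric.ball v r, ∀ m ∈ M, l m x < a := fun i v => by
    by_cases hv : v ∈ V i ∧ {v} ∉ M
    · obtain ⟨hv, hvM⟩ := hv
      have hMfin : M.Finite := (hT i).finite.subset (hMT i)
      have hlt : ∀ m ∈ M, l m v < w i v := fun m hm => (hl m hm i).2 v hv fun hvm =>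
        hvM (hdown m hm _ (Finset.singleton_subset_iff.2 hvm) (Finset.singleton_nonempty v))
      obtain ⟨δ, hδ, hδ0⟩ := ((eventually_add_mul_lt hMfin (b := fun _ => 1) hlt).and
        self_mem_nhdsWithin).exists
      have hδ0 : 0 < δ := hδ0
      have h1 : ∀ᶠ x in nhds v, ∀ m ∈ M, l m x < w i v - δ :=
        (Filter.eventually_all_finite hMfin).2 fun m hm =>
          (l m).continuous_of_finiteDimensional.continuousAt.eventually
            (gt_mem_nhds (by linarith [hδ m hm]))
      obtain ⟨r, hr, hball⟩ := Metric.eventually_nhds_iff_ball.1 h1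
      exact ⟨r, w i v - δ, fun _ _ => ⟨hr, by linarith, hball⟩⟩
    · exact ⟨0, 0, fun h1 h2 => absurd ⟨h1, h2⟩ hv⟩
  choose r a hra using hball
  have hU : ∀ i v, ∃ U : κ → Set E, v ∈ V i → {v} ∉ M →
      (∀ k, IsOpen (U k) ∧ (U k).Nonempty ∧ U k ⊆ Metric.ball v (r i v)) ∧
      ∀ (l : E →ᵃ[ℝ] ℝ) (x : κ → E),
        (∀ k, x k ∈ U k) → ∃ k, l v ≤ l (x k) := fun i v => by
    by_cases hv : v ∈ V i ∧ {v} ∉ M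
    · obtain ⟨U, hU⟩ := hsur v _ (hra i v hv.1 hv.2).1
      exact ⟨U, fun _ _ => hU⟩
    · exact ⟨fun _ => ∅, fun h1 h2 => absurd ⟨h1, h2⟩ hv⟩
  choose U hU using hU
  set J : Finset (Bool × E × κ) :=
    (Finset.univ ×ˢ (Finset.univ.biUnion V) ×ˢ Finset.univ).filter fun q =>
      q.2.1 ∈ V q.1 ∧ {q.2.1} ∉ M with hJ
  have hJmem : ∀ i v k, v ∈ V i → {v} ∉ M → (i, v, k) ∈ J := fun i v k hv hvM => by
    simp only [hJ, Finset.mem_filter, Finset.mem_product, Finset.mem_univ, Finset.mem_biUnion,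
      true_and, and_true]
    exact ⟨⟨i, hv⟩, hv, hvM⟩
  obtain ⟨X, w', T', hT', hTP', hpath, hw', hwX, hX⟩ := exists_insert_family hE hdown hfr J
    (U := fun q => U q.1 q.2.1 q.2.2) (a := fun q => a q.1 q.2.1) (b := fun q => w q.1 q.2.1)
    (l := l) (fun ⟨i, v, k⟩ hq => by
      obtain ⟨-, hv, hvM⟩ := Finset.mem_filter.1 hq
      obtain ⟨h1, h2, h3⟩ := (hU i v hv hvM).1 k
      obtain ⟨-, h4, h5⟩ := hra i v hv hvM
      exact ⟨h1, h2, h4, fun x hx => h5 x (h3 hx)⟩) V w T hT hTP hMT hl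
  have hkey : ∀ i, ∀ s ∈ (T' i).faces, ∀ v ∈ s, v ∈ V i → v ∉ X → {v} ∈ M := by
    intro i s hs v hvs hv hvX
    by_contra hvM
    choose x hx using fun k => hX _ (hJmem i v k hv hvM)
    obtain ⟨g, hg1, hg2⟩ := (hT' i).cert s hs
    obtain ⟨k, hk⟩ := (hU i v hv hvM).2 g x fun k => (hx k).2.1
    have h1 : g (x k) ≤ w' i (x k) := by
      by_cases hxs : x k ∈ s
      · exact (hg1 _ hxs).le
      · exact (hg2 _ (Finset.mem_union_right _ (hx k).1) hxs).le
    have h2 := (hx k).2.2 i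
    have h3 := hg1 v hvs
    rw [hw' i v hv] at h3
    simp only at h2
    linarith
  set W : Finset E := (V true).filter (fun v => {v} ∈ M) ∪ X with hW
  have hVM : ∀ i v, {v} ∈ M → v ∈ V i := fun i v hv =>
    (hT i).subset _ (hMT i hv) (Finset.mem_singleton_self v)
  have hWV : ∀ i, W ⊆ V i ∪ X := fun i => Finset.union_subset_union_left fun v hv =>
    hVM i v (Finset.mem_filter.1 hv).2
  have hWw : ∀ i, ∀ v ∈ W, w' i v = w' true v := fun i v hv => by
    rcases Finset.mem_union.1 hv with hv | hv
    · have hvM := (Finset.mem_filter.1 hv).2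
      rw [hw' i v (hVM i v hvM), hw' true v (hVM true v hvM), hw i true v hvM]
    · exact hwX i true v hv
  have hT'' : ∀ i, Certified W (w' true) (T' i) := fun i => by
    have hsub : ∀ s ∈ (T' i).faces, s ⊆ W := fun s hs v hv => by
      by_cases hvX : v ∈ X
      · exact Finset.mem_union_right _ hvX
      · have hvV := (Finset.mem_union.1 ((hT' i).subset s hs hv)).resolve_right hvX
        have hvM := hkey i s hs v hv hvV hvX
        exact Finset.mem_union_left _ (Finset.mem_filter.2 ⟨hVM true v hvM, hvM⟩)
    refine ⟨hsub, fun s hs => ?_⟩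
    obtain ⟨g, hg1, hg2⟩ := (hT' i).cert s hs
    exact ⟨g, fun v hv => by rw [hg1 v hv, hWw i v (hsub s hs hv)],
      fun v hv hvs => by rw [← hWw i v hv]; exact hg2 v (hWV i hv) hvs⟩
  have heq : T' i = T' j := (hT'' i).eq_of_space_eq (hT'' j) (by rw [hTP', hTP'])
  have h1 := hpath i
  have h2 := (hpath j).symm
  rw [heq] at h1
  exact h1.trans h2

end BistellarDerived

/-- Let `K` be a simplicial triangulation of a compact flat polyhedron
`P ⊂ ℝⁿ` whose support is an `n`-manifold with boundary, let `L` be a (possibly empty)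
subcomplex of `K` with `|L| ⊇ ∂P`, and let `αK` be a subdivision of `K` agreeing with `K` on
`|L|`. Then there are `s ∈ ℕ` and `s`-fold derived subdivisions `βˢ(αK)` and `βˢK`, agreeing on
a common `s`-fold derived subdivision `βˢL` of `L`, related by geometric bistellar moves each
keeping `βˢL` fixed. -/
theorem statement9 {n : ℕ} [NeZero n] (P : Set (Fin n → ℝ))
    (hPcompact : IsCompact P) (hPflat : (interior P).Nonempty)
    (hPmanifold : Nonempty (ChartedSpace (EuclideanHalfSpace n) P))
    (K : Geometry.SimplicialComplex ℝ (Fin n → ℝ))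
    (hKfin : K.faces.Finite) (hK : K.space = P)
    (L : Geometry.SimplicialComplex ℝ (Fin n → ℝ))
    (hLsub : L.faces = {s ∈ K.faces | convexHull ℝ (s : Set (Fin n → ℝ)) ⊆ L.space})
    (hLbd : frontier P ⊆ L.space)
    (αK : Geometry.SimplicialComplex ℝ (Fin n → ℝ))
    (hαfin : αK.faces.Finite) (hα : IsSubdivision αK K)
    (hαL : {s ∈ αK.faces | convexHull ℝ (s : Set (Fin n → ℝ)) ⊆ L.space} = L.faces) :
    ∃ (s : ℕ) (B₁ B₂ BL : Geometry.SimplicialComplex ℝ (Fin n → ℝ)),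
      IsIterDerived s B₁ αK ∧ IsIterDerived s B₂ K ∧ IsIterDerived s BL L ∧
      BL.faces ⊆ B₁.faces ∧ BL.faces ⊆ B₂.faces ∧
      Relation.ReflTransGen
        (fun X Y => BistellarMove n X Y ∧ BL.faces ⊆ X.faces ∧ BL.faces ⊆ Y.faces)
        B₁ B₂ := by
  have hC : ∀ i, (bif i then αK else K).faces.Finite := by
    rintro (_ | _)
    exacts [hKfin, hαfin]
  have hLC : ∀ i, L.faces ⊆ (bif i then αK else K).faces := by
    rintro (_ | _) s hs
    · rw [hLsub] at hs
      exact hs.1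
    · rw [← hαL] at hs
      exact hs.1
  obtain ⟨m, D, BL, V, w, hD, hBL, hBLD, hDC, hBLL, hcert, hw, l, hl⟩ :=
    BistellarDerived.exists_certified hC hLC
  refine ⟨m, D true, D false, BL, hD true, hD false, hBL, hBLD true, hBLD false, ?_⟩
  have hfr : frontier P ⊆ BL.space := hBLL.symm ▸ hLbd
  have hDP : ∀ i, (D i).space = P := by
    rintro (_ | _)
    · exact (hDC false).trans hK
    · exact (hDC true).trans (hα.1.trans hK)
  have hpath := BistellarDerived.exists_path_of_certified (P := P)
    (by rw [Module.finrank_fin_fun]; exact Nat.pos_of_ne_zero (NeZero.ne n))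
    (fun v r hr => BistellarDerived.exists_surrounding v hr)
    (fun s hs t hts ht => BL.down_closed hs hts ht) hfr hcert hDP hBLD hl
    (fun i j v hv => hw i j v hv) true false
  rwa [Module.finrank_fin_fun] at hpath
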